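/- arXiv:2008.07400 — 2 statements merged into one kernel-verified Lean document; each statement's English description precedes it below -/
import Mathlib

section
/- Let C > 0. There exist K > 0 and x₀ > 0 such that for all x ≥ x₀ and all real ν with 0 ≤ ν ≤ x/(1+C): |J_ν(x) − (2/π)^{1/2}·(x² − ν²)^{−1/4}·cos(πx·g(ν/x) − π/4)| ≤ K·(x² − ν²)^{−1/4}·x^{−1}. -/
open Real MeasureTheory

/-- The Bessel function of real order `ν ≥ 0`:
`J_ν(x) = (1/π)∫₀^π cos(x sin t − ν t) dt − (sin(νπ)/π)∫₀^∞ e^{−x sinh t − ν t} dt`. -/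
noncomputable def besselJnu (ν x : ℝ) : ℝ :=
  (1 / π) * (∫ t in (0:ℝ)..π, Real.cos (x * Real.sin t - ν * t)) -
    (Real.sin (ν * π) / π) * ∫ t in Set.Ioi (0:ℝ), Real.exp (-(x * Real.sinh t) - ν * t)

/-- `g(r) = (1/π)(√(1−r²) − r·arccos r)`. -/
noncomputable def gfun (r : ℝ) : ℝ :=
  (1 / π) * (Real.sqrt (1 - r ^ 2) - r * Real.arccos r)


namespace BJ
open Set Filter Topology

noncomputable def bint (n : ℕ) (ν x : ℝ) : ℝ :=
  ∫ t in Ioi (0:ℝ), (sinh t) ^ n * exp (-(x * sinh t) - ν * t)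

lemma bint_ptwise (n : ℕ) {ν x t : ℝ} (hν : 0 ≤ ν) (hx : 0 < x) (ht : 0 < t) :
    (sinh t) ^ n * exp (-(x * sinh t) - ν * t) ≤
      (n.factorial * (2 / x) ^ n) * exp (-(x / 2) * t) := by
  have hs : t ≤ sinh t := self_le_sinh_iff.2 ht.le
  have hs0 : 0 < sinh t := ht.trans_le hs
  have h1 := pow_div_factorial_le_exp (x / 2 * sinh t) (by positivity) n
  have h2 : (sinh t) ^ n ≤ (n.factorial * (2 / x) ^ n) * exp (x / 2 * sinh t) := by
    rw [div_le_iff₀ (by positivity)] at h1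
    calc (sinh t) ^ n = (2 / x) ^ n * (x / 2 * sinh t) ^ n := by
          rw [← mul_pow]; congr 1; field_simp
      _ ≤ (2 / x) ^ n * (exp (x / 2 * sinh t) * n.factorial) := by gcongr
      _ = _ := by ring
  calc (sinh t) ^ n * exp (-(x * sinh t) - ν * t)
      ≤ ((n.factorial * (2 / x) ^ n) * exp (x / 2 * sinh t)) * exp (-(x * sinh t) - ν * t) := by
        gcongr
    _ = (n.factorial * (2 / x) ^ n) * exp (x / 2 * sinh t + (-(x * sinh t) - ν * t)) := by
        rw [mul_assoc, ← exp_add]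
    _ ≤ _ := by
        gcongr
        nlinarith [mul_nonneg hν ht.le]

lemma bint_integrable (n : ℕ) {ν x : ℝ} (hν : 0 ≤ ν) (hx : 0 < x) :
    IntegrableOn (fun t => (sinh t) ^ n * exp (-(x * sinh t) - ν * t)) (Ioi 0) := by
  refine Integrable.mono' (((exp_neg_integrableOn_Ioi 0 (b := x / 2) (by positivity)).const_mul
    (n.factorial * (2 / x) ^ n))) ?_ ?_
  · exact Continuous.aestronglyMeasurable (by fun_prop)
  · filter_upwards [ae_restrict_mem measurableSet_Ioi] with t ht
    have hs0 : 0 < sinh t := sinh_pos_iff.2 ht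
    rw [norm_of_nonneg (by positivity)]
    exact bint_ptwise n hν hx ht

lemma bint_bound (n : ℕ) {ν x : ℝ} (hν : 0 ≤ ν) (hx : 0 < x) :
    |bint n ν x| ≤ n.factorial * (2 / x) ^ (n + 1) := by
  have h0 : 0 ≤ bint n ν x := by
    refine setIntegral_nonneg measurableSet_Ioi fun t ht => ?_
    have hs0 : 0 < sinh t := sinh_pos_iff.2 ht
    positivity
  rw [abs_of_nonneg h0]
  have := setIntegral_mono_on (bint_integrable n hν hx)
    ((exp_neg_integrableOn_Ioi 0 (b := x / 2) (by positivity)).const_mul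
    (n.factorial * (2 / x) ^ n)) measurableSet_Ioi (fun t ht => bint_ptwise n hν hx ht)
  refine this.trans (le_of_eq ?_)
  rw [integral_const_mul, integral_exp_mul_Ioi (by linarith)]
  simp
  field_simp
  rw [pow_succ]; field_simp

lemma bint_deriv (n : ℕ) {ν x : ℝ} (hν : 0 ≤ ν) (hx : 0 < x) :
    HasDerivAt (bint n ν) (-bint (n + 1) ν x) x := by
  have := (hasDerivAt_integral_of_dominated_loc_of_deriv_le (μ := volume.restrict (Ioi (0:ℝ)))
    (F := fun y t => (sinh t) ^ n * exp (-(y * sinh t) - ν * t))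
    (F' := fun y t => -((sinh t) ^ (n + 1) * exp (-(y * sinh t) - ν * t)))
    (bound := fun t => (sinh t) ^ (n + 1) * exp (-((x / 2) * sinh t) - ν * t))
    (x₀ := x) (s := Ioi (x / 2)) (Ioi_mem_nhds (by linarith)) ?_ (bint_integrable n hν hx) ?_ ?_
    (bint_integrable (n + 1) hν (by positivity)) ?_).2
  · rw [integral_neg] at this
    exact this
  · exact Eventually.of_forall fun y => Continuous.aestronglyMeasurable (by fun_prop)
  · exact Continuous.aestronglyMeasurable (by fun_prop)
  · filter_upwards [ae_restrict_mem measurableSet_Ioi] with t ht y hy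
    have hs0 : 0 < sinh t := sinh_pos_iff.2 ht
    rw [norm_neg, norm_of_nonneg (by positivity)]
    have : x / 2 < y := hy
    gcongr
  · refine Eventually.of_forall fun t y _ => ?_
    have h1 : HasDerivAt (fun y : ℝ => -(y * sinh t) - ν * t) (-(1 * sinh t)) y :=
      (((hasDerivAt_id y).mul_const _).neg).sub_const _
    exact (h1.exp.const_mul ((sinh t) ^ n)).congr_deriv (by ring)

lemma bint_ode {ν x : ℝ} (hν : 0 ≤ ν) (hx : 0 < x) :
    x ^ 2 * bint 2 ν x - x * bint 1 ν x + (x ^ 2 - ν ^ 2) * bint 0 ν x = x - ν := by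
  have i0 := bint_integrable 0 hν hx
  have i1 := bint_integrable 1 hν hx
  have i2 := bint_integrable 2 hν hx
  have key := integral_Ioi_of_hasDerivAt_of_tendsto (a := 0) (m := (0:ℝ))
    (f := fun t => -((x * cosh t - ν) * exp (-(x * sinh t) - ν * t)))
    (f' := fun t => x ^ 2 * ((sinh t) ^ 2 * exp (-(x * sinh t) - ν * t))
      - x * ((sinh t) ^ 1 * exp (-(x * sinh t) - ν * t))
      + (x ^ 2 - ν ^ 2) * ((sinh t) ^ 0 * exp (-(x * sinh t) - ν * t))) ?_ ?_ ?_ ?_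
  · rw [integral_add, integral_sub, integral_const_mul, integral_const_mul,
      integral_const_mul] at key
    · simp only [bint]
      rw [key]; simp
    · exact i2.const_mul _
    · exact i1.const_mul _
    · exact (i2.const_mul _).sub (i1.const_mul _)
    · exact i0.const_mul _
  · exact Continuous.continuousWithinAt (by fun_prop)
  · intro t _
    have h1 : HasDerivAt (fun t : ℝ => -(x * sinh t) - ν * t) (-(x * cosh t) - ν * 1) t :=
      (((hasDerivAt_sinh t).const_mul x).neg).sub ((hasDerivAt_id t).const_mul ν)
    have h2 : HasDerivAt (fun t : ℝ => x * cosh t - ν) (x * sinh t) t :=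
      ((hasDerivAt_cosh t).const_mul x).sub_const ν
    refine (h2.mul h1.exp).neg.congr_deriv ?_
    have := cosh_sq t
    linear_combination (x ^ 2 * exp (-(x * sinh t) - ν * t)) * this
  · exact ((i2.const_mul _).sub (i1.const_mul _)).add (i0.const_mul _)
  · -- tends to zero
    have hz : Tendsto (fun t : ℝ => (2 * x + ν) * (8 / x ^ 2 * exp (-(x / 2) * t) 
        + exp (-(x / 2) * t))) atTop (𝓝 0) := by
      have : Tendsto (fun t : ℝ => exp (-(x / 2) * t)) atTop (𝓝 0) := by
        refine tendsto_exp_atBot.comp ?_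
        exact tendsto_id.const_mul_atTop_of_neg (by linarith)
      simpa using ((this.const_mul (8 / x ^ 2)).add this).const_mul (2 * x + ν)
    refine squeeze_zero_norm' ?_ hz
    filter_upwards [eventually_gt_atTop 0] with t ht
    have b0 := bint_ptwise 0 hν hx ht
    have b2 := bint_ptwise 2 hν hx ht
    simp only [pow_zero, one_mul, Nat.factorial] at b0 b2
    set e := exp (-(x * sinh t) - ν * t) with he
    have e0 : 0 < e := exp_pos _
    have hc : cosh t ≤ 1 + sinh t ^ 2 := by
      nlinarith [cosh_sq t, one_le_cosh t]
    have hc1 := one_le_cosh t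
    rw [norm_neg, norm_mul, norm_of_nonneg e0.le]
    have : ‖x * cosh t - ν‖ ≤ (2 * x + ν) * (1 + sinh t ^ 2) := by
      rw [Real.norm_eq_abs, abs_le]
      constructor <;> nlinarith [mul_nonneg hν (sq_nonneg (sinh t)), mul_nonneg hx.le (sq_nonneg (sinh t)), mul_le_mul_of_nonneg_left hc hx.le]
    calc _ ≤ (2 * x + ν) * (1 + sinh t ^ 2) * e := by gcongr
      _ = (2 * x + ν) * (sinh t ^ 2 * e + e) := by ring
      _ ≤ _ := by
        refine mul_le_mul_of_nonneg_left (add_le_add ?_ ?_) (by positivity)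
        · refine b2.trans (le_of_eq ?_)
          push_cast; ring
        · simpa using b0

noncomputable def aint0 (ν x : ℝ) : ℝ := ∫ t in (0:ℝ)..π, cos (x * sin t - ν * t)
noncomputable def aint1 (ν x : ℝ) : ℝ := ∫ t in (0:ℝ)..π, -(sin t * sin (x * sin t - ν * t))
noncomputable def aint2 (ν x : ℝ) : ℝ :=
  ∫ t in (0:ℝ)..π, -(sin t * (sin t * cos (x * sin t - ν * t)))

lemma lin_deriv (ν t y : ℝ) : HasDerivAt (fun y : ℝ => y * sin t - ν * t) (sin t) y := by
  simpa using ((hasDerivAt_id y).mul_const (sin t)).sub_const (ν * t)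

lemma aint0_deriv (ν x : ℝ) : HasDerivAt (aint0 ν) (aint1 ν x) x := by
  refine (intervalIntegral.hasDerivAt_integral_of_dominated_loc_of_deriv_le (μ := volume)
    (F := fun y t => cos (y * sin t - ν * t))
    (F' := fun y t => -(sin t * sin (y * sin t - ν * t)))
    (bound := fun _ => 1) (x₀ := x) (s := univ) univ_mem ?_ ?_ ?_ ?_ ?_ ?_).2
  · exact Eventually.of_forall fun y => Continuous.aestronglyMeasurable (by fun_prop)
  · exact Continuous.intervalIntegrable (by fun_prop) _ _
  · exact Continuous.aestronglyMeasurable (by fun_prop)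
  · refine Eventually.of_forall fun t _ y _ => ?_
    rw [norm_neg, norm_mul]
    exact mul_le_one₀ (abs_sin_le_one _) (norm_nonneg _) (abs_sin_le_one _)
  · exact Continuous.intervalIntegrable (by fun_prop) _ _
  · refine Eventually.of_forall fun t _ y _ => ?_
    exact (lin_deriv ν t y).cos.congr_deriv (by ring)

lemma aint1_deriv (ν x : ℝ) : HasDerivAt (aint1 ν) (aint2 ν x) x := by
  refine (intervalIntegral.hasDerivAt_integral_of_dominated_loc_of_deriv_le (μ := volume)
    (F := fun y t => -(sin t * sin (y * sin t - ν * t)))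
    (F' := fun y t => -(sin t * (sin t * cos (y * sin t - ν * t))))
    (bound := fun _ => 1) (x₀ := x) (s := univ) univ_mem ?_ ?_ ?_ ?_ ?_ ?_).2
  · exact Eventually.of_forall fun y => Continuous.aestronglyMeasurable (by fun_prop)
  · exact Continuous.intervalIntegrable (by fun_prop) _ _
  · exact Continuous.aestronglyMeasurable (by fun_prop)
  · refine Eventually.of_forall fun t _ y _ => ?_
    rw [norm_neg, norm_mul, norm_mul]
    exact mul_le_one₀ (abs_sin_le_one _) (by positivity)
      (mul_le_one₀ (abs_sin_le_one _) (norm_nonneg _) (abs_cos_le_one _))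
  · exact Continuous.intervalIntegrable (by fun_prop) _ _
  · refine Eventually.of_forall fun t _ y _ => ?_
    exact ((lin_deriv ν t y).sin.const_mul (sin t)).neg.congr_deriv (by ring)

lemma aint_ode (ν x : ℝ) :
    x ^ 2 * aint2 ν x + x * aint1 ν x + (x ^ 2 - ν ^ 2) * aint0 ν x
      = (x - ν) * sin (ν * π) := by
  have key := intervalIntegral.integral_eq_sub_of_hasDerivAt (a := 0) (b := π)
    (f := fun t => (x * cos t + ν) * sin (x * sin t - ν * t))
    (f' := fun t => x ^ 2 * (-(sin t * (sin t * cos (x * sin t - ν * t))))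
      + x * (-(sin t * sin (x * sin t - ν * t))) + (x ^ 2 - ν ^ 2) * cos (x * sin t - ν * t))
    ?_ (Continuous.intervalIntegrable (by fun_prop) _ _)
  · rw [intervalIntegral.integral_add (Continuous.intervalIntegrable (by fun_prop) _ _)
      (Continuous.intervalIntegrable (by fun_prop) _ _),
      intervalIntegral.integral_add (Continuous.intervalIntegrable (by fun_prop) _ _)
      (Continuous.intervalIntegrable (by fun_prop) _ _),
      intervalIntegral.integral_const_mul, intervalIntegral.integral_const_mul,
      intervalIntegral.integral_const_mul] at key
    simp only [aint0, aint1, aint2]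
    rw [key]; simp; ring
  · intro t _
    have h1 : HasDerivAt (fun t : ℝ => x * sin t - ν * t) (x * cos t - ν * 1) t :=
      ((hasDerivAt_sin t).const_mul x).sub ((hasDerivAt_id t).const_mul ν)
    have h2 : HasDerivAt (fun t : ℝ => x * cos t + ν) (x * (-sin t)) t :=
      ((hasDerivAt_cos t).const_mul x).add_const ν
    refine (h2.mul h1.sin).congr_deriv ?_
    have := sin_sq_add_cos_sq t
    linear_combination (x ^ 2 * cos (x * sin t - ν * t)) * this

noncomputable def J1 (ν x : ℝ) : ℝ := 1 / π * aint1 ν x + sin (ν * π) / π * bint 1 ν x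
noncomputable def J2 (ν x : ℝ) : ℝ := 1 / π * aint2 ν x - sin (ν * π) / π * bint 2 ν x

lemma bessel_eq (ν x : ℝ) :
    besselJnu ν x = 1 / π * aint0 ν x - sin (ν * π) / π * bint 0 ν x := by
  simp [besselJnu, aint0, bint]

lemma J_deriv {ν x : ℝ} (hν : 0 ≤ ν) (hx : 0 < x) :
    HasDerivAt (besselJnu ν) (J1 ν x) x := by
  have : besselJnu ν = fun x => 1 / π * aint0 ν x - sin (ν * π) / π * bint 0 ν x :=
    funext (bessel_eq ν)
  rw [this]
  exact (((aint0_deriv ν x).const_mul (1 / π)).sub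
    ((bint_deriv 0 hν hx).const_mul (sin (ν * π) / π))).congr_deriv (by simp [J1])

lemma J1_deriv {ν x : ℝ} (hν : 0 ≤ ν) (hx : 0 < x) :
    HasDerivAt (J1 ν) (J2 ν x) x := by
  exact (((aint1_deriv ν x).const_mul (1 / π)).add
    ((bint_deriv 1 hν hx).const_mul (sin (ν * π) / π))).congr_deriv (by simp [J2]; ring)

lemma J_ode {ν x : ℝ} (hν : 0 ≤ ν) (hx : 0 < x) :
    x ^ 2 * J2 ν x + x * J1 ν x + (x ^ 2 - ν ^ 2) * besselJnu ν x = 0 := by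
  rw [bessel_eq, J1, J2]
  have a := aint_ode ν x
  have b := bint_ode hν hx
  linear_combination (1 / π) * a - sin (ν * π) / π * b

end BJ

namespace BJ
open Set Filter Topology

lemma even_bounds {N : ℝ → ℝ} (hN : ContDiff ℝ 2 N) (h0 : N 0 = 0) (he : ∀ s, N (-s) = N s) :
    ∃ c : ℝ, 0 ≤ c ∧ ∀ s ∈ Icc 0 (π / 2), |deriv N s| ≤ c * s ∧ |N s| ≤ c * s ^ 2 := by
  have hd0 : deriv N 0 = 0 := by
    have := deriv_comp_neg N 0
    simp only [he, neg_zero] at this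
    linarith
  have hd1 : ContDiff ℝ 1 (deriv N) := by
    have : ContDiff ℝ (1 + 1) N := by norm_num; exact hN
    exact (contDiff_succ_iff_deriv.1 this).2.2
  have hc : Continuous (deriv (deriv N)) := hd1.continuous_deriv le_rfl
  obtain ⟨c, hcb⟩ := isCompact_Icc.exists_bound_of_continuousOn (s := Icc 0 (π / 2)) hc.continuousOn
  have hpi := pi_pos
  have c0 : 0 ≤ c := (norm_nonneg _).trans (hcb 0 ⟨le_rfl, by positivity⟩)
  have b1 : ∀ s ∈ Icc 0 (π / 2), |deriv N s| ≤ c * s := by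
    intro s hs
    have := (convex_Icc 0 (π / 2)).norm_image_sub_le_of_norm_deriv_le (f := deriv N) (C := c)
      (x := 0) (y := s) (fun x _ => (hd1.differentiable one_ne_zero) x) hcb ⟨le_rfl, by positivity⟩ hs
    simpa [hd0, abs_of_nonneg hs.1] using this
  refine ⟨c, c0, fun s hs => ⟨b1 s hs, ?_⟩⟩
  have := (convex_Icc 0 s).norm_image_sub_le_of_norm_deriv_le (f := N) (C := c * s)
      (x := 0) (y := s) (fun x _ => (hN.differentiable two_ne_zero) x) 
      (fun y hy => (b1 y ⟨hy.1, hy.2.trans hs.2⟩).trans (by gcongr; exact hy.2))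
      ⟨le_rfl, hs.1⟩ ⟨hs.1, le_rfl⟩
  simp [h0, abs_of_nonneg hs.1] at this
  linarith

lemma osc_norm (x s : ℝ) : ‖Complex.exp (-(Complex.I * x * ((1 - cos s : ℝ) : ℂ)))‖ = 1 := by
  have : -(Complex.I * x * ((1 - cos s : ℝ) : ℂ)) = ((-(x * (1 - cos s)) : ℝ) : ℂ) * Complex.I := by
    push_cast; ring
  rw [this, Complex.norm_exp_ofReal_mul_I]

lemma osc_bound {N : ℝ → ℝ} (hN : ContDiff ℝ 2 N) (h0 : N 0 = 0) (he : ∀ s, N (-s) = N s) :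
    ∃ T : ℝ, ∀ x : ℝ, 0 < x → ‖∫ s in (0:ℝ)..(π / 2),
      Complex.exp (-(Complex.I * x * ((1 - cos s : ℝ) : ℂ))) * (N s : ℂ)‖ ≤ T / x := by
  obtain ⟨c, c0, hb⟩ := even_bounds hN h0 he
  have hpi := pi_pos
  have hNd : ∀ s, HasDerivAt N (deriv N s) s := fun s =>
    ((hN.differentiable two_ne_zero) s).hasDerivAt
  have hNc : Continuous N := hN.continuous
  have hN'c : Continuous (deriv N) := hN.continuous_deriv (by norm_num)
  have hsin : ∀ s ∈ Icc 0 (π / 2), 2 / π * s ≤ sin s := fun s hs => mul_le_sin hs.1 hs.2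
  have hq : ∀ s ∈ Icc 0 (π / 2), |N s / sin s| ≤ c * π / 2 * s := by
    intro s hs
    rcases hs.1.eq_or_lt with h | h
    · rw [← h]; simp
    · have h1 := hsin s hs
      have h2 : 0 < 2 / π * s := by positivity
      rw [abs_div, abs_of_pos (h2.trans_le h1), div_le_iff₀ (h2.trans_le h1)]
      calc |N s| ≤ c * s ^ 2 := (hb s hs).2
        _ = c * π / 2 * s * (2 / π * s) := by field_simp
        _ ≤ _ := by gcongr
  have hqc : ContinuousOn (fun s => N s / sin s) (Icc 0 (π / 2)) := by
    intro s hs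
    rcases hs.1.eq_or_lt with h | h
    · subst h
      rw [ContinuousWithinAt]
      simp only [sin_zero, div_zero]
      have : Tendsto (fun s => c * π / 2 * s) (𝓝[Icc 0 (π / 2)] 0) (𝓝 0) := by
        have : Continuous (fun s => c * π / 2 * s) := by fun_prop
        have := this.tendsto 0
        simp only [mul_zero] at this
        exact this.mono_left nhdsWithin_le_nhds
      refine squeeze_zero_norm' ?_ this
      filter_upwards [self_mem_nhdsWithin] with s hs
      exact hq s hs
    · have : 0 < sin s := lt_of_lt_of_le (by positivity) (hsin s hs)
      exact (hNc.continuousAt.div continuous_sin.continuousAt this.ne').continuousWithinAt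
  set q' : ℝ → ℝ := fun s => (deriv N s * sin s - N s * cos s) / sin s ^ 2 with hq'
  have hq'b : ∀ s ∈ Ioc 0 (π / 2), |q' s| ≤ c * π ^ 2 / 2 := by
    intro s hs'
    have hs : s ∈ Icc 0 (π / 2) := ⟨hs'.1.le, hs'.2⟩
    have h1 := hsin s hs
    have h2 : 0 < 2 / π * s := mul_pos (by positivity) hs'.1
    have h3 := h2.trans_le h1
    rw [hq', abs_div, abs_of_pos (pow_pos h3 2), div_le_iff₀ (pow_pos h3 2)]
    have h4 : |deriv N s * sin s - N s * cos s| ≤ 2 * c * s ^ 2 := by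
      refine (abs_sub _ _).trans ?_
      rw [abs_mul, abs_mul, abs_of_pos h3]
      have := (hb s hs).1
      have h5 := (hb s hs).2
      have : |deriv N s| * sin s ≤ c * s * s := by
        gcongr
        · exact mul_nonneg c0 hs.1
        · exact sin_le hs.1
      have : |N s| * |cos s| ≤ c * s ^ 2 * 1 := by
        gcongr
        exact abs_cos_le_one s
      linarith
    calc _ ≤ 2 * c * s ^ 2 := h4
      _ = c * π ^ 2 / 2 * (2 / π * s) ^ 2 := by field_simp
      _ ≤ _ := by gcongr
  have hqd : ∀ s ∈ Ioo 0 (π / 2), HasDerivAt (fun s => N s / sin s) (q' s) s := by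
    intro s hs
    have : 0 < sin s := lt_of_lt_of_le (mul_pos (by positivity) hs.1) (hsin s ⟨hs.1.le, hs.2.le⟩)
    exact (hNd s).div (hasDerivAt_sin s) this.ne'
  have hq'm : Measurable q' := by
    refine Measurable.div ?_ ?_
    · exact Continuous.measurable (by fun_prop)
    · exact Continuous.measurable (by fun_prop)
  refine ⟨c * π / 2 * (π / 2) + c * π ^ 2 / 2 * |π / 2 - 0|, fun x hx => ?_⟩
  set e : ℝ → ℂ := fun s => Complex.exp (-(Complex.I * x * ((1 - cos s : ℝ) : ℂ))) with hedef
  have hec : Continuous e := by fun_prop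
  have hed : ∀ s, HasDerivAt e (e s * (-(Complex.I * x * (sin s : ℂ)))) s := by
    intro s
    have h1 : HasDerivAt (fun s : ℝ => ((1 - cos s : ℝ) : ℂ)) ((sin s : ℝ) : ℂ) s := by
      refine HasDerivAt.ofReal_comp ?_
      simpa using (hasDerivAt_cos s).const_sub 1
    exact ((h1.const_mul (Complex.I * x)).neg).cexp
  have hen : ∀ s, ‖e s‖ = 1 := fun s => osc_norm x s
  have i1 : IntervalIntegrable (fun s => -(Complex.I * x) * (e s * (N s : ℂ))) volume 0 (π / 2) :=
    Continuous.intervalIntegrable (by fun_prop) _ _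
  have i2 : IntervalIntegrable (fun s => e s * (q' s : ℂ)) volume 0 (π / 2) := by
    have : IntervalIntegrable (fun _ : ℝ => c * π ^ 2 / 2) volume 0 (π / 2) :=
      intervalIntegrable_const
    refine this.mono_fun' ?_ ?_
    · exact (hec.measurable.mul (Complex.measurable_ofReal.comp hq'm)).aestronglyMeasurable
    · filter_upwards [ae_restrict_mem measurableSet_uIoc] with s hs
      rw [uIoc_of_le (by positivity)] at hs
      rw [norm_mul, hen, one_mul, Complex.norm_real]
      exact hq'b s hs
  have key := intervalIntegral.integral_eq_sub_of_hasDerivAt_of_le (a := 0) (b := π / 2)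
    (f := fun s => e s * ((N s / sin s : ℝ) : ℂ))
    (f' := fun s => -(Complex.I * x) * (e s * (N s : ℂ)) + e s * (q' s : ℂ))
    (by positivity) ?_ ?_ (i1.add i2)
  · rw [intervalIntegral.integral_add i1 i2, intervalIntegral.integral_const_mul] at key
    simp only [sin_zero, div_zero, Complex.ofReal_zero, mul_zero, sub_zero] at key
    have key2 : (Complex.I * x) * (∫ s in (0:ℝ)..(π / 2), e s * (N s : ℂ))
        = -(e (π / 2) * ((N (π / 2) / sin (π / 2) : ℝ) : ℂ))
          + ∫ s in (0:ℝ)..(π / 2), e s * (q' s : ℂ) := by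
      linear_combination -key
    have n1 : ‖e (π / 2) * ((N (π / 2) / sin (π / 2) : ℝ) : ℂ)‖ ≤ c * π / 2 * (π / 2) := by
      rw [norm_mul, hen, one_mul, Complex.norm_real]
      exact hq (π / 2) ⟨by positivity, le_rfl⟩
    have n2 : ‖∫ s in (0:ℝ)..(π / 2), e s * (q' s : ℂ)‖ ≤ c * π ^ 2 / 2 * |π / 2 - 0| := by
      refine intervalIntegral.norm_integral_le_of_norm_le_const fun s hs => ?_
      rw [uIoc_of_le (by positivity)] at hs
      rw [norm_mul, hen, one_mul, Complex.norm_real]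
      exact hq'b s hs
    rw [le_div_iff₀ hx]
    have n3 := congrArg norm key2
    rw [norm_mul, norm_mul, Complex.norm_I, one_mul, Complex.norm_real, norm_of_nonneg hx.le] at n3
    rw [mul_comm, n3]
    refine (norm_add_le _ _).trans ?_
    rw [norm_neg]
    exact add_le_add n1 n2
  · exact hec.continuousOn.mul (Complex.continuous_ofReal.comp_continuousOn hqc)
  · intro s hs
    have hs0 : sin s ≠ 0 := 
      (lt_of_lt_of_le (mul_pos (by positivity) hs.1) (hsin s ⟨hs.1.le, hs.2.le⟩)).ne'
    refine ((hed s).mul (hqd s hs).ofReal_comp).congr_deriv ?_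
    have : (sin s : ℂ) ≠ 0 := by exact_mod_cast hs0
    push_cast at *
    field_simp

lemma tail_bound {a : ℝ} (ha : 0 < a) : ∃ T : ℝ, ∀ x : ℝ, 0 < x →
    ‖∫ w in Ioi a, Complex.exp (-(2 * (1 + Complex.I * x)) * (w : ℂ) ^ 2)‖ ≤ T / x := by
  refine ⟨1 / (4 * a) + 1 / 4 * ∫ w in Ioi a, 1 / a ^ 2 * exp (-2 * w ^ 2), fun x hx => ?_⟩
  set β : ℂ := 2 * (1 + Complex.I * x) with hβ
  have hre : β.re = 2 := by simp [hβ]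
  have him : β.im = 2 * x := by simp [hβ]
  have hβ0 : β ≠ 0 := by
    intro h; rw [h] at hre; simp at hre
  have hβn : 2 * x ≤ ‖β‖ := by
    have := Complex.abs_im_le_norm β
    rw [him, abs_of_pos (by positivity)] at this
    exact this
  set E : ℝ → ℂ := fun w => Complex.exp (-β * (w : ℂ) ^ 2) with hE
  have hEn : ∀ w, ‖E w‖ = exp (-2 * w ^ 2) := by
    intro w
    rw [hE, Complex.norm_exp]
    congr 1
    rw [← Complex.ofReal_pow, Complex.re_mul_ofReal]
    simp [hre]
  have hEc : Continuous E := by fun_prop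
  have hEi : IntegrableOn E (Ioi a) := 
    (integrable_cexp_neg_mul_sq (b := β) (by rw [hre]; norm_num)).integrableOn
  have gi : IntegrableOn (fun w : ℝ => 1 / a ^ 2 * exp (-2 * w ^ 2)) (Ioi a) :=
    ((integrable_exp_neg_mul_sq (b := 2) (by norm_num)).integrableOn).const_mul _
  have hEb : ∀ w ∈ Ioi a, ‖E w / (w : ℂ) ^ 2‖ ≤ 1 / a ^ 2 * exp (-2 * w ^ 2) := by
    intro w hw
    have hw' : a < w := hw
    rw [norm_div, hEn, norm_pow, Complex.norm_real, norm_of_nonneg (ha.trans hw').le, div_eq_inv_mul,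
      ← one_div]
    gcongr
  have hEm : AEStronglyMeasurable (fun w : ℝ => E w / (w : ℂ) ^ 2) (volume.restrict (Ioi a)) := by
    refine (hEc.measurable.div ?_).aestronglyMeasurable
    exact Continuous.measurable (by fun_prop)
  have hEi2 : IntegrableOn (fun w : ℝ => E w / (w : ℂ) ^ 2) (Ioi a) := by
    refine gi.mono' hEm ?_
    filter_upwards [ae_restrict_mem measurableSet_Ioi] with w hw
    exact hEb w hw
  have key := integral_Ioi_of_hasDerivAt_of_tendsto (a := a) (m := (0:ℂ))
    (f := fun w : ℝ => E w / (-2 * β * w))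
    (f' := fun w : ℝ => E w + 1 / (2 * β) * (E w / (w : ℂ) ^ 2)) ?_ ?_ 
    (hEi.add (hEi2.const_mul _)) ?_
  · rw [integral_add hEi (hEi2.const_mul _), integral_const_mul] at key
    have k2 : (∫ w in Ioi a, E w) = - (E a / (-2 * β * a)) 
        - 1 / (2 * β) * ∫ w in Ioi a, E w / (w : ℂ) ^ 2 := by linear_combination key
    rw [k2]
    have n1 : ‖E a / (-2 * β * a)‖ ≤ (1 / (4 * a)) / x := by
      rw [norm_div, hEn, norm_mul, norm_mul, Complex.norm_real, norm_of_nonneg ha.le, div_div]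
      simp only [norm_neg, Complex.norm_ofNat]
      have : exp (-2 * a ^ 2) ≤ 1 := exp_le_one_iff.2 (by nlinarith)
      exact div_le_div₀ zero_le_one this (by positivity) (by nlinarith)
    have n2 : ‖∫ w in Ioi a, E w / (w : ℂ) ^ 2‖ ≤ ∫ w in Ioi a, 1 / a ^ 2 * exp (-2 * w ^ 2) := by
      refine norm_integral_le_of_norm_le gi ?_
      filter_upwards [ae_restrict_mem measurableSet_Ioi] with w hw
      exact hEb w hw
    have n3 : ‖1 / (2 * β)‖ ≤ 1 / 4 / x := by
      rw [norm_div, norm_mul, div_div]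
      simp only [norm_one, Complex.norm_ofNat]
      exact one_div_le_one_div_of_le (by positivity) (by linarith)
    refine (norm_sub_le _ _).trans ?_
    rw [norm_neg, norm_mul, add_div]
    refine add_le_add n1 ?_
    calc _ ≤ 1 / 4 / x * ∫ w in Ioi a, 1 / a ^ 2 * exp (-2 * w ^ 2) := by gcongr
      _ = _ := by ring
  · refine ContinuousAt.continuousWithinAt ?_
    refine ContinuousAt.div hEc.continuousAt (by fun_prop) ?_
    simp [hβ0, ha.ne']
  · intro w hw
    have hw' : a < w := hw
    have hw0 : (w : ℂ) ≠ 0 := by exact_mod_cast (ha.trans hw').ne'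
    have h0 : HasDerivAt (fun w : ℝ => (w : ℂ)) 1 w := Complex.ofRealCLM.hasDerivAt
    have h1 : HasDerivAt E (E w * (-β * (2 * (w : ℂ)))) w := by
      have := ((h0.pow 2).const_mul (-β)).cexp
      exact this.congr_deriv (by simp [hE])
    have h2 := h1.div (h0.const_mul (-2 * β)) (by simp [hβ0, hw0])
    refine h2.congr_deriv ?_
    field_simp
    ring
  · have hz : Tendsto (fun w : ℝ => 1 / (2 * ‖β‖) * w⁻¹) atTop (𝓝 0) := by
      simpa using tendsto_inv_atTop_zero.const_mul (1 / (2 * ‖β‖))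
    refine squeeze_zero_norm' ?_ hz
    filter_upwards [eventually_gt_atTop 0] with w hw
    rw [norm_div, hEn, norm_mul, norm_mul, Complex.norm_real, norm_of_nonneg hw.le]
    simp only [norm_neg, Complex.norm_ofNat]
    have : exp (-2 * w ^ 2) ≤ 1 := exp_le_one_iff.2 (by nlinarith)
    have hb : 0 < ‖β‖ := norm_pos_iff.2 hβ0
    calc _ ≤ 1 / (2 * ‖β‖ * w) := by gcongr
      _ = _ := by field_simp

end BJ

namespace BJ
open Set Filter Topology

noncomputable def G : ℂ := ((π / 2 : ℝ) * (-Complex.I)) ^ (1 / 2 : ℂ)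

lemma cpow_half_mul {r : ℝ} (hr : 0 < r) {z : ℂ} (hz : z ≠ 0) :
    ((r : ℂ) * z) ^ (1 / 2 : ℂ) = (√r : ℂ) * z ^ (1 / 2 : ℂ) := by
  have hr' : (r : ℂ) ≠ 0 := by exact_mod_cast hr.ne'
  rw [Complex.cpow_def_of_ne_zero (mul_ne_zero hr' hz), Complex.log_ofReal_mul hr hz,
    Complex.cpow_def_of_ne_zero hz, add_mul, Complex.exp_add]
  congr 1
  rw [sqrt_eq_rpow, rpow_def_of_pos hr]
  push_cast
  rfl

lemma G_eq : G = (√(π / 2) : ℂ) * Complex.exp (-(π / 4 * Complex.I)) := by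
  have hpi := pi_pos
  rw [G, cpow_half_mul (by positivity) (by simp), Complex.cpow_def_of_ne_zero (by simp),
    Complex.log_neg_I]
  congr 2
  ring

noncomputable def Kf (s : ℝ) : ℝ := cos (s / 2) * exp (-(1 - cos s))

lemma one_sub_cos (s : ℝ) : 1 - cos s = 2 * sin (s / 2) ^ 2 := by
  have := cos_sq' (s / 2)
  have h2 := cos_two_mul (s / 2)
  rw [show 2 * (s / 2) = s by ring] at h2
  rw [h2, this]; ring

lemma Kint (x : ℝ) : ∫ s in (0:ℝ)..(π / 2),
      Complex.exp (-(Complex.I * x * ((1 - cos s : ℝ) : ℂ))) * (Kf s : ℂ)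
    = (π / (2 * (1 + Complex.I * x))) ^ (1 / 2 : ℂ)
      - 2 * ∫ w in Ioi (sin (π / 4)), Complex.exp (-(2 * (1 + Complex.I * x)) * (w : ℂ) ^ 2) := by
  have hre : (0:ℝ) < (2 * (1 + Complex.I * x)).re := by simp
  have h1 := intervalIntegral.integral_deriv_smul_comp (a := 0) (b := π / 2)
    (f := fun s => sin (s / 2)) (f' := fun s => cos (s / 2) * (1 / 2))
    (g := fun w : ℝ => Complex.exp (-(2 * (1 + Complex.I * x)) * (w : ℂ) ^ 2)) ?_ ?_ ?_
  · have h2 := intervalIntegral.integral_Ioi_sub_Ioi (a := 0) (b := sin (π / 4))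
      (f := fun w : ℝ => Complex.exp (-(2 * (1 + Complex.I * x)) * (w : ℂ) ^ 2)) (μ := volume)
      (integrable_cexp_neg_mul_sq hre).integrableOn
      (sin_nonneg_of_nonneg_of_le_pi (by positivity) (by linarith [pi_pos]))
    rw [integral_gaussian_complex_Ioi hre] at h2
    simp only [zero_div, sin_zero, show π / 2 / 2 = π / 4 by ring] at h1
    have h3 : ∫ s in (0:ℝ)..(π / 2),
      Complex.exp (-(Complex.I * x * ((1 - cos s : ℝ) : ℂ))) * (Kf s : ℂ) = 
        2 * ∫ s in (0:ℝ)..(π / 2), (cos (s / 2) * (1 / 2)) • ((fun w : ℝ => Complex.exp (-(2 * (1 + Complex.I * x)) * (w : ℂ) ^ 2)) ∘ fun s => sin (s / 2)) s := by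
      rw [← intervalIntegral.integral_const_mul]
      refine intervalIntegral.integral_congr fun s _ => ?_
      simp only [Kf, Function.comp, Complex.real_smul]
      rw [one_sub_cos]
      push_cast
      have : Complex.exp (-(2 * (1 + Complex.I * x)) * Complex.sin (s / 2) ^ 2)
        = Complex.exp (-(Complex.I * x * (2 * Complex.sin (s / 2) ^ 2))) * 
          Complex.exp (-(2 * Complex.sin (s / 2) ^ 2)) := by
        rw [← Complex.exp_add]; congr 1; ring
      rw [this]; ring
    rw [h3, h1]
    linear_combination -2 * h2
  · intro s _
    exact ((hasDerivAt_id s).div_const 2).sin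
  · exact Continuous.continuousOn (by fun_prop)
  · fun_prop

lemma sqrt_mul_div_tendsto (T : ℝ) : Tendsto (fun x : ℝ => √x * (T / x)) atTop (𝓝 0) := by
  have : Tendsto (fun x : ℝ => T * (√x)⁻¹) atTop (𝓝 0) := by
    simpa using (tendsto_inv_atTop_zero.comp tendsto_sqrt_atTop).const_mul T
  refine this.congr' ?_
  filter_upwards [eventually_gt_atTop 0] with x hx
  have := sq_sqrt hx.le
  have h2 := sqrt_pos.2 hx
  field_simp
  linear_combination -T * this

lemma sqrt_mul_norm_tendsto {f : ℝ → ℂ} {T : ℝ} (h : ∀ x : ℝ, 0 < x → ‖f x‖ ≤ T / x) :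
    Tendsto (fun x : ℝ => (√x : ℂ) * f x) atTop (𝓝 0) := by
  refine squeeze_zero_norm' ?_ (sqrt_mul_div_tendsto T)
  filter_upwards [eventually_gt_atTop 0] with x hx
  rw [norm_mul, Complex.norm_real, norm_of_nonneg (sqrt_nonneg _)]
  gcongr
  exact h x hx

lemma gauss_lim : Tendsto (fun x : ℝ => (√x : ℂ) * ∫ s in (0:ℝ)..(π / 2),
      Complex.exp (-(Complex.I * x * ((1 - cos s : ℝ) : ℂ))) * (Kf s : ℂ)) atTop (𝓝 G) := by
  have ha : 0 < sin (π / 4) := sin_pos_of_pos_of_lt_pi (by positivity) (by linarith [pi_pos])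
  obtain ⟨T, hT⟩ := tail_bound ha
  have t1 := (sqrt_mul_norm_tendsto hT).const_mul 2
  have t2 : Tendsto (fun x : ℝ => ((x : ℂ) * (π / (2 * (1 + Complex.I * x)))) ^ (1 / 2 : ℂ)) atTop
      (𝓝 G) := by
    have hc : Tendsto (fun x : ℝ => (x : ℂ) * (π / (2 * (1 + Complex.I * x)))) atTop
        (𝓝 ((π / 2 : ℝ) * (-Complex.I))) := by
      have h0 : Tendsto (fun x : ℝ => ((x⁻¹ : ℝ) : ℂ)) atTop (𝓝 ((0:ℝ):ℂ)) :=
        (Complex.continuous_ofReal.tendsto 0).comp tendsto_inv_atTop_zero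
      have h1 : Tendsto (fun x : ℝ => (π : ℂ) / (2 * (((x⁻¹ : ℝ) : ℂ) + Complex.I))) atTop
          (𝓝 ((π : ℂ) / (2 * (((0 : ℝ) : ℂ) + Complex.I)))) :=
        tendsto_const_nhds.div ((h0.add_const _).const_mul 2) (by simp)
      have h2 : (π : ℂ) / (2 * (((0 : ℝ) : ℂ) + Complex.I)) = (π / 2 : ℝ) * (-Complex.I) := by
        rw [div_eq_iff (by simp)]
        push_cast
        linear_combination (π:ℂ) * Complex.I_mul_I
      rw [h2] at h1
      refine h1.congr' ?_
      filter_upwards [eventually_gt_atTop 0] with x hx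
      have hx' : (x : ℂ) ≠ 0 := by exact_mod_cast hx.ne'
      have e : 2 * (1 + Complex.I * x) = x * (2 * (((x⁻¹ : ℝ) : ℂ) + Complex.I)) := by
        push_cast; field_simp
      rw [e, mul_div_assoc', mul_div_mul_left _ _ hx']
    refine Tendsto.cpow hc tendsto_const_nhds ?_
    right
    simp
  have t3 := t2.sub t1
  simp only [mul_zero, sub_zero] at t3
  refine t3.congr' ?_
  filter_upwards [eventually_gt_atTop 0] with x hx
  rw [Kint, cpow_half_mul hx]
  · ring
  · refine div_ne_zero (by exact_mod_cast pi_pos.ne') ?_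
    intro h
    have := congrArg Complex.re h
    simp at this

lemma stat_phase {H : ℝ → ℝ} (hH : ContDiff ℝ 2 H) (h1 : H 0 = 1) (he : ∀ s, H (-s) = H s) :
    Tendsto (fun x : ℝ => (√x : ℂ) * ∫ s in (0:ℝ)..(π / 2),
      Complex.exp (-(Complex.I * x * ((1 - cos s : ℝ) : ℂ))) * (H s : ℂ)) atTop (𝓝 G) := by
  have hK : ContDiff ℝ 2 Kf := by unfold Kf; fun_prop
  obtain ⟨T, hT⟩ := osc_bound (N := fun s => H s - Kf s) (hH.sub hK) (by simp [h1, Kf])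
    (by intro s; simp [he, Kf, neg_div])
  have t := (sqrt_mul_norm_tendsto hT).add gauss_lim
  rw [zero_add] at t
  refine t.congr fun x => ?_
  rw [← mul_add, ← intervalIntegral.integral_add]
  · congr 1
    refine intervalIntegral.integral_congr fun s _ => ?_
    push_cast; ring
  · have := hH.continuous
    have := hK.continuous
    exact Continuous.intervalIntegrable (by fun_prop) _ _
  · have := hK.continuous
    exact Continuous.intervalIntegrable (by fun_prop) _ _

lemma fold_int {f : ℝ → ℝ} (hf : Continuous f) :
    ∫ t in (0:ℝ)..π, f t = ∫ s in (0:ℝ)..(π / 2), (f (π / 2 - s) + f (π / 2 + s)) := by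
  rw [intervalIntegral.integral_add (Continuous.intervalIntegrable (by fun_prop) _ _)
    (Continuous.intervalIntegrable (by fun_prop) _ _),
    intervalIntegral.integral_comp_sub_left (fun t => f t),
    intervalIntegral.integral_comp_add_left (fun t => f t)]
  rw [sub_self, sub_zero, add_zero, add_halves]
  exact (intervalIntegral.integral_add_adjacent_intervals (hf.intervalIntegrable _ _)
    (hf.intervalIntegrable _ _)).symm

noncomputable def S (H : ℝ → ℝ) (x : ℝ) : ℂ := ∫ s in (0:ℝ)..(π / 2),
      Complex.exp (-(Complex.I * x * ((1 - cos s : ℝ) : ℂ))) * (H s : ℂ)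

lemma S_mul (H : ℝ → ℝ) (hH : Continuous H) (x φ : ℝ) :
    Complex.exp (φ * Complex.I) * S H x = 
      ((∫ s in (0:ℝ)..(π / 2), cos (φ - x + x * cos s) * H s : ℝ) : ℂ) +
      ((∫ s in (0:ℝ)..(π / 2), sin (φ - x + x * cos s) * H s : ℝ) : ℂ) * Complex.I := by
  rw [S, ← intervalIntegral.integral_ofReal, ← intervalIntegral.integral_ofReal,
    ← intervalIntegral.integral_const_mul, ← intervalIntegral.integral_mul_const,
    ← intervalIntegral.integral_add (Continuous.intervalIntegrable (by fun_prop) _ _)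
    (Continuous.intervalIntegrable (by fun_prop) _ _)]
  refine intervalIntegral.integral_congr fun s _ => ?_
  rw [← mul_assoc, ← Complex.exp_add,
    show φ * Complex.I + -(Complex.I * x * ((1 - cos s : ℝ) : ℂ)) = 
      ((φ - x + x * cos s : ℝ) : ℂ) * Complex.I by push_cast; ring, Complex.exp_mul_I]
  push_cast
  ring

lemma aint0_eq (ν x : ℝ) : aint0 ν x = 2 * (Complex.exp (((x - ν * (π / 2) : ℝ) : ℂ) * Complex.I) *
    S (fun s => cos (ν * s)) x).re := by
  rw [S_mul _ (by fun_prop), aint0, fold_int (by fun_prop)]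
  simp only [Complex.add_re, Complex.ofReal_re, Complex.mul_re, Complex.I_re, mul_zero, 
    Complex.ofReal_im, Complex.I_im, zero_mul, sub_self, add_zero]
  rw [← intervalIntegral.integral_const_mul]
  refine intervalIntegral.integral_congr fun s _ => ?_
  simp only [sin_pi_div_two_sub]
  rw [add_comm (π / 2) s, sin_add_pi_div_two,
    show x * cos s - ν * (π / 2 - s) = (x - ν * (π / 2) - x + x * cos s) + ν * s by ring,
    show x * cos s - ν * (s + π / 2) = (x - ν * (π / 2) - x + x * cos s) - ν * s by ring,
    cos_add, cos_sub]
  ring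

lemma aint1_eq (ν x : ℝ) : aint1 ν x = -2 * (Complex.exp (((x - ν * (π / 2) : ℝ) : ℂ) * Complex.I) *
    S (fun s => cos (ν * s) * cos s) x).im := by
  rw [S_mul _ (by fun_prop), aint1, fold_int (by fun_prop)]
  simp only [Complex.add_im, Complex.ofReal_re, Complex.mul_im, Complex.I_re, mul_zero, 
    Complex.ofReal_im, Complex.I_im, mul_one, zero_add, add_zero]
  rw [← intervalIntegral.integral_const_mul]
  refine intervalIntegral.integral_congr fun s _ => ?_
  simp only [sin_pi_div_two_sub]
  rw [add_comm (π / 2) s, sin_add_pi_div_two,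
    show x * cos s - ν * (π / 2 - s) = (x - ν * (π / 2) - x + x * cos s) + ν * s by ring,
    show x * cos s - ν * (s + π / 2) = (x - ν * (π / 2) - x + x * cos s) - ν * s by ring,
    sin_add, sin_sub]
  ring

lemma sqrt_bint_tendsto (n : ℕ) {ν : ℝ} (hν : 0 ≤ ν) :
    Tendsto (fun x : ℝ => √x * bint n ν x) atTop (𝓝 0) := by
  refine squeeze_zero_norm' ?_ (sqrt_mul_div_tendsto (n.factorial * 2 ^ (n + 1)))
  filter_upwards [eventually_ge_atTop 1] with x hx
  rw [norm_mul, norm_of_nonneg (sqrt_nonneg _)]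
  gcongr
  refine (bint_bound n hν (by linarith)).trans ?_
  rw [div_pow, ← mul_div_assoc]
  gcongr
  exact le_self_pow₀ hx (by simp)

lemma J_asymp {ν : ℝ} (hν : 0 ≤ ν) :
    Tendsto (fun x : ℝ => √x * besselJnu ν x -
      2 / π * (Complex.exp (((x - ν * (π / 2) : ℝ) : ℂ) * Complex.I) * G).re) atTop (𝓝 0) := by
  have hs := stat_phase (H := fun s => cos (ν * s)) (by fun_prop) (by simp) (by simp)
  have h1 : Tendsto (fun x : ℝ => 2 / π * (Complex.exp (((x - ν * (π / 2) : ℝ) : ℂ) * Complex.I) *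
      ((√x : ℂ) * S (fun s => cos (ν * s)) x - G)).re) atTop (𝓝 0) := by
    have := (tendsto_iff_norm_sub_tendsto_zero.1 hs).const_mul (2 / π)
    rw [mul_zero] at this
    refine squeeze_zero_norm (fun x => ?_) this
    rw [norm_mul, norm_of_nonneg (by positivity)]
    gcongr
    refine (Complex.abs_re_le_norm _).trans ?_
    rw [norm_mul, Complex.norm_exp_ofReal_mul_I, one_mul]
    rfl
  have h2 := h1.sub ((sqrt_bint_tendsto 0 hν).const_mul (sin (ν * π) / π))
  simp only [mul_zero, sub_zero] at h2
  refine h2.congr fun x => ?_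
  rw [bessel_eq, aint0_eq]
  have : Complex.exp (((x - ν * (π / 2) : ℝ) : ℂ) * Complex.I) *
      ((√x : ℂ) * S (fun s => cos (ν * s)) x - G) = 
      (√x : ℂ) * (Complex.exp (((x - ν * (π / 2) : ℝ) : ℂ) * Complex.I) * S (fun s => cos (ν * s)) x)
      - Complex.exp (((x - ν * (π / 2) : ℝ) : ℂ) * Complex.I) * G := by ring
  rw [this, Complex.sub_re, Complex.re_ofReal_mul]
  ring

lemma J1_asymp {ν : ℝ} (hν : 0 ≤ ν) :
    Tendsto (fun x : ℝ => √x * J1 ν x +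
      2 / π * (Complex.exp (((x - ν * (π / 2) : ℝ) : ℂ) * Complex.I) * G).im) atTop (𝓝 0) := by
  have hs := stat_phase (H := fun s => cos (ν * s) * cos s) (by fun_prop) (by simp) (by simp)
  have h1 : Tendsto (fun x : ℝ => 2 / π * (Complex.exp (((x - ν * (π / 2) : ℝ) : ℂ) * Complex.I) *
      ((√x : ℂ) * S (fun s => cos (ν * s) * cos s) x - G)).im) atTop (𝓝 0) := by
    have := (tendsto_iff_norm_sub_tendsto_zero.1 hs).const_mul (2 / π)
    rw [mul_zero] at this
    refine squeeze_zero_norm (fun x => ?_) this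
    rw [norm_mul, norm_of_nonneg (by positivity)]
    gcongr
    refine (Complex.abs_im_le_norm _).trans ?_
    rw [norm_mul, Complex.norm_exp_ofReal_mul_I, one_mul]
    rfl
  have h2 := ((sqrt_bint_tendsto 1 hν).const_mul (sin (ν * π) / π)).sub h1
  simp only [mul_zero, sub_zero] at h2
  refine h2.congr fun x => ?_
  rw [J1, aint1_eq]
  have : Complex.exp (((x - ν * (π / 2) : ℝ) : ℂ) * Complex.I) *
      ((√x : ℂ) * S (fun s => cos (ν * s) * cos s) x - G) = 
      (√x : ℂ) * (Complex.exp (((x - ν * (π / 2) : ℝ) : ℂ) * Complex.I) *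
        S (fun s => cos (ν * s) * cos s) x)
      - Complex.exp (((x - ν * (π / 2) : ℝ) : ℂ) * Complex.I) * G := by ring
  rw [this, Complex.sub_im, Complex.im_ofReal_mul]
  ring

end BJ

namespace BJ
open Set Filter Topology

lemma wkb_abstract {W W' : ℝ → ℂ} {x₀ c : ℝ} {L : ℂ} (hx : 0 < x₀) (hc : 0 ≤ c)
    (hd : ∀ y, x₀ ≤ y → HasDerivAt W (W' y) y)
    (hb : ∀ y, x₀ ≤ y → ‖W' y‖ ≤ c / y ^ 2 * ‖W y‖)
    (hL : Tendsto W atTop (𝓝 L)) :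
    ‖W x₀ - L‖ ≤ c * (exp (c / x₀) * ‖L‖) / x₀ := by
  have hinv : ∀ (k y : ℝ), 0 < y → HasDerivAt (fun y : ℝ => k / y) (-k / y ^ 2) y := by
    intro k y hy
    simpa [div_eq_mul_inv] using (hasDerivAt_inv hy.ne').const_mul k
  have hM : ∀ y, x₀ ≤ y → HasDerivAt (fun y => ‖W y‖ ^ 2 * exp (-(2 * c) / y))
      (2 * inner ℝ (W y) (W' y) * exp (-(2 * c) / y) +
        ‖W y‖ ^ 2 * (exp (-(2 * c) / y) * (-(-(2 * c)) / y ^ 2))) y := fun y hy =>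
    ((hd y hy).norm_sq).mul (hinv _ y (hx.trans_le hy)).exp
  have hmono : MonotoneOn (fun y => ‖W y‖ ^ 2 * exp (-(2 * c) / y)) (Ici x₀) := by
    refine monotoneOn_of_hasDerivWithinAt_nonneg (convex_Ici x₀)
      (fun y hy => (hM y hy).continuousAt.continuousWithinAt)
      (fun y hy => (hM y (interior_subset hy)).hasDerivWithinAt) fun y hy => ?_
    have hy := interior_subset hy
    have h1 := abs_real_inner_le_norm (W y) (W' y)
    have h2 := hb y hy
    have h3 : |inner ℝ (W y) (W' y)| ≤ c / y ^ 2 * ‖W y‖ ^ 2 := by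
      refine h1.trans ?_
      calc _ ≤ ‖W y‖ * (c / y ^ 2 * ‖W y‖) := by gcongr
        _ = _ := by ring
    have h4 := (abs_le.1 h3).1
    have e0 := exp_pos (-(2 * c) / y)
    have : 0 ≤ 2 * (inner ℝ (W y) (W' y) + c / y ^ 2 * ‖W y‖ ^ 2) * exp (-(2 * c) / y) := by
      have : 0 ≤ inner ℝ (W y) (W' y) + c / y ^ 2 * ‖W y‖ ^ 2 := by linarith
      positivity
    refine this.trans (le_of_eq ?_)
    ring
  have hlimM : Tendsto (fun y => ‖W y‖ ^ 2 * exp (-(2 * c) / y)) atTop (𝓝 (‖L‖ ^ 2)) := by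
    have h1 : Tendsto (fun y : ℝ => exp (-(2 * c) / y)) atTop (𝓝 1) := by
      have := (continuous_exp.tendsto 0).comp (tendsto_const_nhds (x := -(2 * c)).div_atTop tendsto_id)
      simpa [Function.comp_def] using this
    simpa using (hL.norm.pow 2).mul h1
  have hbd : ∀ y, x₀ ≤ y → ‖W y‖ ≤ exp (c / x₀) * ‖L‖ := by
    intro y hy
    have hy0 := hx.trans_le hy
    have h1 : ‖W y‖ ^ 2 * exp (-(2 * c) / y) ≤ ‖L‖ ^ 2 := by
      refine ge_of_tendsto hlimM ?_
      filter_upwards [eventually_ge_atTop y] with z hz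
      exact hmono hy (hy.trans hz) hz
    have h2 : (‖W y‖ * exp (-c / y)) ^ 2 ≤ ‖L‖ ^ 2 := by
      rw [mul_pow, ← exp_nat_mul]
      refine le_trans (le_of_eq ?_) h1
      congr 2
      push_cast; ring
    have h3 := (abs_le_of_sq_le_sq' h2 (norm_nonneg _)).2
    calc ‖W y‖ = exp (c / y) * (‖W y‖ * exp (-c / y)) := by
          rw [mul_left_comm, ← exp_add]; simp [neg_div]
      _ ≤ exp (c / x₀) * ‖L‖ := by gcongr
  set M := exp (c / x₀) * ‖L‖ with hMdef
  have hM0 : 0 ≤ M := by positivity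
  have hdiff : ∀ y, x₀ ≤ y → ‖W y - W x₀‖ ≤ c * M / x₀ := by
    intro y hy
    have := image_norm_le_of_norm_deriv_right_le_deriv_boundary' (a := x₀) (b := y)
      (f := fun z => W z - W x₀) (f' := W') (B := fun z => c * M / x₀ + -(c * M) / z)
      (B' := fun z => -(-(c * M)) / z ^ 2)
      (fun z hz => ((hd z hz.1).continuousAt.sub continuousAt_const).continuousWithinAt)
      (fun z hz => ((hd z hz.1).sub_const _).hasDerivWithinAt)
      (by simp [neg_div])
      (fun z hz => (((hinv (-(c * M)) z (hx.trans_le hz.1)).const_add _).continuousAt).continuousWithinAt)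
      (fun z hz => ((hinv (-(c * M)) z (hx.trans_le hz.1)).const_add _).hasDerivWithinAt)
      (fun z hz => by
        refine (hb z hz.1).trans ?_
        rw [neg_neg, mul_div_right_comm]
        have := hx.trans_le hz.1
        gcongr
        exact hbd z hz.1) ⟨hy, le_rfl⟩
    refine this.trans ?_
    have : 0 ≤ c * M / y := div_nonneg (by positivity) (hx.le.trans hy)
    rw [neg_div]; linarith
  have hl : Tendsto (fun y => ‖W y - W x₀‖) atTop (𝓝 ‖L - W x₀‖) := (hL.sub_const _).norm
  rw [norm_sub_rev]
  refine le_of_tendsto hl ?_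
  filter_upwards [eventually_ge_atTop x₀] with y hy
  exact hdiff y hy

noncomputable def ξ (ν x : ℝ) : ℝ := √(x ^ 2 - ν ^ 2) - ν * arccos (ν / x)
noncomputable def amp (ν x : ℝ) : ℝ := (x ^ 2 - ν ^ 2) ^ (-(1:ℝ) / 4)
noncomputable def W (ν x : ℝ) : ℂ := (amp ν x : ℂ) * Complex.exp (ξ ν x * Complex.I) *
  (((-(x ^ 2 / (2 * (x ^ 2 - ν ^ 2)) * besselJnu ν x) - x * J1 ν x : ℝ) : ℂ) +
    ((√(x ^ 2 - ν ^ 2) * besselJnu ν x : ℝ) : ℂ) * Complex.I)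

lemma P_pos {ν x : ℝ} (hν : 0 ≤ ν) (hx : ν < x) : 0 < x ^ 2 - ν ^ 2 := by nlinarith

lemma P_deriv (ν x : ℝ) : HasDerivAt (fun x : ℝ => x ^ 2 - ν ^ 2) (2 * x) x := by
  simpa using (hasDerivAt_pow 2 x).sub_const (ν ^ 2)

lemma amp_deriv {ν x : ℝ} (hν : 0 ≤ ν) (hx : ν < x) :
    HasDerivAt (amp ν) (-(x / (2 * (x ^ 2 - ν ^ 2))) * amp ν x) x := by
  have hP := P_pos hν hx
  refine ((P_deriv ν x).rpow_const (p := -(1:ℝ) / 4) (Or.inl hP.ne')).congr_deriv ?_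
  rw [amp, rpow_sub_one hP.ne']
  field_simp
  ring

lemma sqrt_deriv {ν x : ℝ} (hν : 0 ≤ ν) (hx : ν < x) :
    HasDerivAt (fun x => √(x ^ 2 - ν ^ 2)) (x / √(x ^ 2 - ν ^ 2)) x := by
  have hP := P_pos hν hx
  refine ((P_deriv ν x).sqrt hP.ne').congr_deriv ?_
  have := sqrt_pos.2 hP
  field_simp

lemma sqrt_one_sub {ν x : ℝ} (hx : 0 < x) :
    √(1 - (ν / x) ^ 2) = √(x ^ 2 - ν ^ 2) / x := by
  rw [show 1 - (ν / x) ^ 2 = (x ^ 2 - ν ^ 2) / x ^ 2 by field_simp, sqrt_div' _ (by positivity),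
    sqrt_sq hx.le]

lemma xi_deriv {ν x : ℝ} (hν : 0 ≤ ν) (hx : ν < x) :
    HasDerivAt (ξ ν) (√(x ^ 2 - ν ^ 2) / x) x := by
  have hP := P_pos hν hx
  have hx0 : 0 < x := hν.trans_lt hx
  have hr1 : ν / x < 1 := (div_lt_one hx0).2 hx
  have hr0 : 0 ≤ ν / x := by positivity
  have h1 : HasDerivAt (fun y : ℝ => ν / y) (-ν / x ^ 2) x := by
    simpa [div_eq_mul_inv] using (hasDerivAt_inv hx0.ne').const_mul ν
  have h2 := (hasDerivAt_arccos (x := ν / x) (by linarith) hr1.ne).comp x h1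
  refine ((sqrt_deriv hν hx).sub (h2.const_mul ν)).congr_deriv ?_
  rw [sqrt_one_sub hx0]
  have hp := sqrt_pos.2 hP
  have hs := sq_sqrt hP.le
  field_simp
  linear_combination (-1) * hs

lemma W_deriv {ν x : ℝ} (hν : 0 ≤ ν) (hx : ν < x) :
    HasDerivAt (W ν) ((amp ν x * (x * (x ^ 2 + 4 * ν ^ 2) / (4 * (x ^ 2 - ν ^ 2) ^ 2)) *
      besselJnu ν x : ℝ) * Complex.exp (ξ ν x * Complex.I)) x := by
  have hP := P_pos hν hx
  have hx0 : 0 < x := hν.trans_lt hx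
  have hp := sqrt_pos.2 hP
  have hs := sq_sqrt hP.le
  have hJ := J_deriv hν hx0
  have hJ1 := J1_deriv hν hx0
  have hode := J_ode hν hx0
  have hα := ((((hasDerivAt_pow 2 x).div ((P_deriv ν x).const_mul 2) (by positivity)).mul hJ).neg).sub
    ((hasDerivAt_id x).mul hJ1)
  have hβ := (sqrt_deriv hν hx).mul hJ
  have he := ((xi_deriv hν hx).ofReal_comp.mul_const Complex.I).cexp
  have key := ((amp_deriv hν hx).ofReal_comp.mul he).mul
    (hα.ofReal_comp.add (hβ.ofReal_comp.mul_const Complex.I))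
  refine key.congr_deriv ?_
  have hJ2 : J2 ν x = -(x * J1 ν x + (x ^ 2 - ν ^ 2) * besselJnu ν x) / x ^ 2 := by
    rw [eq_div_iff (by positivity)]; linarith
  simp only [Pi.add_apply, Pi.mul_apply, Pi.neg_apply, Pi.sub_apply, Pi.div_apply, id]
  rw [hJ2]
  generalize Complex.exp (ξ ν x * Complex.I) = e
  generalize amp ν x = a
  generalize besselJnu ν x = j
  generalize J1 ν x = j1
  generalize √(x ^ 2 - ν ^ 2) = p at *
  have hν2 : ν ^ 2 = x ^ 2 - p ^ 2 := by linarith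
  rw [hν2]
  have hI := Complex.I_mul_I
  have hp' : (p : ℂ) ≠ 0 := by exact_mod_cast hp.ne'
  have hx' : (x : ℂ) ≠ 0 := by exact_mod_cast hx0.ne'
  push_cast
  simp only [sub_sub_cancel]
  field_simp
  ring_nf
  rw [Complex.I_sq]
  ring

end BJ

namespace BJ
open Set Filter Topology

lemma r_tendsto (ν : ℝ) : Tendsto (fun x : ℝ => 1 - (ν / x) ^ 2) atTop (𝓝 1) := by
  have h : Tendsto (fun x : ℝ => ν / x) atTop (𝓝 0) := tendsto_const_nhds.div_atTop tendsto_id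
  simpa using (h.pow 2).const_sub 1

lemma amp_sqrt {ν x : ℝ} (hν : 0 ≤ ν) (hx : ν < x) :
    amp ν x * √x = (1 - (ν / x) ^ 2) ^ (-(1:ℝ) / 4) := by
  have hP := P_pos hν hx
  have hx0 : 0 < x := hν.trans_lt hx
  have e1 : x ^ 2 - ν ^ 2 = x ^ 2 * (1 - (ν / x) ^ 2) := by field_simp
  have hr : 0 ≤ 1 - (ν / x) ^ 2 := by
    by_contra h
    push Not at h
    rw [e1] at hP
    nlinarith [sq_nonneg x]
  unfold amp
  rw [e1, mul_rpow (by positivity) hr, ← rpow_natCast x 2, ← rpow_mul hx0.le, sqrt_eq_rpow,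
    mul_right_comm, ← rpow_add hx0]
  norm_num

lemma u2_tendsto {ν : ℝ} (hν : 0 ≤ ν) : Tendsto (fun x => amp ν x * √x) atTop (𝓝 1) := by
  have h := (r_tendsto ν).rpow_const (p := -(1:ℝ) / 4) (Or.inl one_ne_zero)
  rw [one_rpow] at h
  refine h.congr' ?_
  filter_upwards [eventually_gt_atTop ν] with x hx
  exact (amp_sqrt hν hx).symm

lemma xi_tendsto {ν : ℝ} (hν : 0 ≤ ν) :
    Tendsto (fun x => ξ ν x - (x - ν * (π / 2))) atTop (𝓝 0) := by
  have h : Tendsto (fun x : ℝ => ν / x) atTop (𝓝 0) := tendsto_const_nhds.div_atTop tendsto_id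
  have h1 : Tendsto (fun x : ℝ => arccos (ν / x)) atTop (𝓝 (π / 2)) := by
    have := (continuous_arccos.tendsto 0).comp h
    rwa [arccos_zero] at this
  have h2 : Tendsto (fun x : ℝ => √(x ^ 2 - ν ^ 2) - x) atTop (𝓝 0) := by
    have h3 : Tendsto (fun x : ℝ => ν ^ 2 / x) atTop (𝓝 0) :=
      tendsto_const_nhds.div_atTop tendsto_id
    refine squeeze_zero_norm' ?_ h3
    filter_upwards [eventually_gt_atTop ν] with x hx
    have hx0 : 0 < x := hν.trans_lt hx
    have hP := P_pos hν hx
    have hs := sq_sqrt hP.le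
    have hp := sqrt_nonneg (x ^ 2 - ν ^ 2)
    rw [Real.norm_eq_abs, le_div_iff₀ hx0, abs_of_nonpos (by nlinarith [sq_nonneg ν])]
    nlinarith [sq_nonneg ν]
  have h4 := h2.sub ((h1.sub_const (π / 2)).const_mul ν)
  simp only [sub_self, mul_zero] at h4
  refine h4.congr fun x => ?_
  unfold ξ; ring

lemma conj_id (φ : ℝ) (g : ℂ) :
    Complex.exp (φ * Complex.I) * (Complex.I * ((Complex.exp (φ * Complex.I) * g).re : ℂ) +
      ((Complex.exp (φ * Complex.I) * g).im : ℂ)) = Complex.I * (starRingEnd ℂ) g := by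
  rw [Complex.exp_mul_I, ← Complex.ofReal_cos, ← Complex.ofReal_sin]
  have h := Real.sin_sq_add_cos_sq φ
  generalize Real.cos φ = c at *
  generalize Real.sin φ = s at *
  apply Complex.ext
  · simp
    linear_combination g.im * h
  · simp
    linear_combination g.re * h

lemma W_tendsto {ν : ℝ} (hν : 0 ≤ ν) :
    Tendsto (W ν) atTop (𝓝 ((2 / π : ℝ) * (Complex.I * (starRingEnd ℂ) G))) := by
  set z : ℝ → ℂ := fun x => Complex.exp (((x - ν * (π / 2) : ℝ) : ℂ) * Complex.I) * G with hz
  have hzn : ∀ x, ‖z x‖ = ‖G‖ := fun x => by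
    simp only [hz, norm_mul, Complex.norm_exp_ofReal_mul_I, one_mul]
  have h0 := J_asymp hν
  have h1 := J1_asymp hν
  set ε0 : ℝ → ℝ := fun x => √x * besselJnu ν x - 2 / π * (z x).re with hε0
  set ε1 : ℝ → ℝ := fun x => √x * J1 ν x + 2 / π * (z x).im with hε1
  change Tendsto ε0 atTop (𝓝 0) at h0
  change Tendsto ε1 atTop (𝓝 0) at h1
  have bd0 : ∀ u : ℝ → ℝ, Tendsto u atTop (𝓝 0) →
      Tendsto (fun x => u x * (√x * besselJnu ν x)) atTop (𝓝 0) := by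
    intro u hu
    have hb : Tendsto (fun x => u x * (z x).re) atTop (𝓝 0) := by
      have := hu.norm.mul_const ‖G‖
      rw [norm_zero, zero_mul] at this
      refine squeeze_zero_norm (fun x => ?_) this
      rw [norm_mul, ← hzn x]
      gcongr
      exact Complex.abs_re_le_norm _
    have := (hb.const_mul (2 / π)).add (hu.mul h0)
    simp only [mul_zero, add_zero] at this
    refine this.congr fun x => ?_
    simp only [hε0]; ring
  have bd1 : ∀ u : ℝ → ℝ, Tendsto u atTop (𝓝 0) →
      Tendsto (fun x => u x * (√x * J1 ν x)) atTop (𝓝 0) := by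
    intro u hu
    have hb : Tendsto (fun x => u x * (z x).im) atTop (𝓝 0) := by
      have := hu.norm.mul_const ‖G‖
      rw [norm_zero, zero_mul] at this
      refine squeeze_zero_norm (fun x => ?_) this
      rw [norm_mul, ← hzn x]
      gcongr
      exact Complex.abs_im_le_norm _
    have := (hb.const_mul (-(2 / π))).add (hu.mul h1)
    simp only [mul_zero, add_zero] at this
    refine this.congr fun x => ?_
    simp only [hε1]; ring
  have hu2 := u2_tendsto hν
  have hr := r_tendsto ν
  have hu1 : Tendsto (fun x => amp ν x * √x * √(1 - (ν / x) ^ 2) - 1) atTop (𝓝 0) := by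
    have := (hu2.mul hr.sqrt).sub_const 1
    simpa using this
  have hu3 : Tendsto (fun x => amp ν x * √x * (x⁻¹ * (1 / (2 * (1 - (ν / x) ^ 2))))) atTop (𝓝 0) := by
    have := hu2.mul (tendsto_inv_atTop_zero.mul
      ((tendsto_const_nhds (x := (1:ℝ))).div (hr.const_mul 2) (by norm_num)))
    simpa using this
  have hu2' : Tendsto (fun x => amp ν x * √x - 1) atTop (𝓝 0) := by
    simpa using hu2.sub_const 1
  have hre : Tendsto (fun x => -ε1 x - (amp ν x * √x * (x⁻¹ * (1 / (2 * (1 - (ν / x) ^ 2))))) *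
      (√x * besselJnu ν x) - (amp ν x * √x - 1) * (√x * J1 ν x)) atTop (𝓝 0) := by
    simpa using (h1.neg.sub (bd0 _ hu3)).sub (bd1 _ hu2')
  have him : Tendsto (fun x => ε0 x + (amp ν x * √x * √(1 - (ν / x) ^ 2) - 1) *
      (√x * besselJnu ν x)) atTop (𝓝 0) := by
    simpa using h0.add (bd0 _ hu1)
  set eR : ℝ → ℝ := fun x => -ε1 x - (amp ν x * √x * (x⁻¹ * (1 / (2 * (1 - (ν / x) ^ 2))))) *
      (√x * besselJnu ν x) - (amp ν x * √x - 1) * (√x * J1 ν x) with heR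
  set eI : ℝ → ℝ := fun x => ε0 x + (amp ν x * √x * √(1 - (ν / x) ^ 2) - 1) *
      (√x * besselJnu ν x) with heI
  have hE : Tendsto (fun x : ℝ => Complex.exp (((x - ν * (π / 2) : ℝ) : ℂ) * Complex.I) *
      ((eR x : ℂ) + (eI x : ℂ) * Complex.I)) atTop (𝓝 0) := by
    have := hre.norm.add him.norm
    rw [norm_zero, add_zero] at this
    refine squeeze_zero_norm (fun x => ?_) this
    rw [norm_mul, Complex.norm_exp_ofReal_mul_I, one_mul]
    refine (norm_add_le _ _).trans ?_
    simp
  have hexp : Tendsto (fun x => Complex.exp (((ξ ν x - (x - ν * (π / 2)) : ℝ) : ℂ) * Complex.I))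
      atTop (𝓝 1) := by
    have hc : Continuous fun s : ℝ => Complex.exp ((s : ℂ) * Complex.I) := by fun_prop
    have := (hc.tendsto 0).comp (xi_tendsto hν)
    simpa [Function.comp_def] using this
  have key := hexp.mul ((tendsto_const_nhds
    (x := ((2 / π : ℝ) : ℂ) * (Complex.I * (starRingEnd ℂ) G))).add hE)
  rw [add_zero, one_mul] at key
  refine key.congr' ?_
  filter_upwards [eventually_gt_atTop ν] with x hx
  have hx0 : 0 < x := hν.trans_lt hx
  have hP := P_pos hν hx
  rw [← conj_id (x - ν * (π / 2)) G]
  have e1 : Complex.exp (ξ ν x * Complex.I) =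
      Complex.exp (((ξ ν x - (x - ν * (π / 2)) : ℝ) : ℂ) * Complex.I) *
      Complex.exp (((x - ν * (π / 2) : ℝ) : ℂ) * Complex.I) := by
    rw [← Complex.exp_add]; congr 1; push_cast; ring
  have hsx : √x * √x = x := mul_self_sqrt hx0.le
  have hR : amp ν x * (-(x ^ 2 / (2 * (x ^ 2 - ν ^ 2)) * besselJnu ν x) - x * J1 ν x) =
      2 / π * (z x).im + eR x := by
    simp only [heR, hε1]
    have : 1 - (ν / x) ^ 2 = (x ^ 2 - ν ^ 2) / x ^ 2 := by field_simp
    rw [this]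
    have h3 : x⁻¹ * (1 / (2 * ((x ^ 2 - ν ^ 2) / x ^ 2))) = x⁻¹ * (x ^ 2 / (2 * (x ^ 2 - ν ^ 2))) := by
      field_simp
    rw [h3]
    generalize x ^ 2 / (2 * (x ^ 2 - ν ^ 2)) = q
    have h4 : x⁻¹ * x = 1 := inv_mul_cancel₀ hx0.ne'
    linear_combination (amp ν x * x⁻¹ * q * besselJnu ν x + amp ν x * J1 ν x) * hsx +
      amp ν x * q * besselJnu ν x * h4
  have hI : amp ν x * (√(x ^ 2 - ν ^ 2) * besselJnu ν x) = 2 / π * (z x).re + eI x := by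
    simp only [heI, hε0]
    rw [sqrt_one_sub hx0]
    have h4 : x⁻¹ * x = 1 := inv_mul_cancel₀ hx0.ne'
    rw [div_eq_mul_inv √(x ^ 2 - ν ^ 2)]
    linear_combination -(amp ν x * √(x ^ 2 - ν ^ 2) * x⁻¹ * besselJnu ν x) * hsx -
      amp ν x * √(x ^ 2 - ν ^ 2) * besselJnu ν x * h4
  have hR' := congrArg (Complex.ofReal) hR
  have hI' := congrArg (Complex.ofReal) hI
  rw [Complex.ofReal_mul, Complex.ofReal_add, Complex.ofReal_mul (2 / π)] at hR' hI'
  unfold W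
  rw [e1]
  simp only [← hz] at *
  change _ * (_ * (_ * (Complex.I * ((z x).re : ℂ) + ((z x).im : ℂ))) + _) = _
  generalize Complex.exp (((ξ ν x - (x - ν * (π / 2)) : ℝ) : ℂ) * Complex.I) = a
  generalize Complex.exp (((x - ν * (π / 2) : ℝ) : ℂ) * Complex.I) = b
  linear_combination (-(a * b)) * hR' - a * b * Complex.I * hI'

lemma amp_sq {ν x : ℝ} (hν : 0 ≤ ν) (hx : ν < x) : amp ν x ^ 2 * √(x ^ 2 - ν ^ 2) = 1 := by
  have hP := P_pos hν hx
  unfold amp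
  rw [← rpow_natCast, ← rpow_mul hP.le, sqrt_eq_rpow, ← rpow_add hP]
  norm_num

lemma amp_pos {ν x : ℝ} (hν : 0 ≤ ν) (hx : ν < x) : 0 < amp ν x :=
  rpow_pos_of_pos (P_pos hν hx) _

lemma J_eq {ν x : ℝ} (hν : 0 ≤ ν) (hx : ν < x) :
    besselJnu ν x = amp ν x * (W ν x * Complex.exp (-(ξ ν x * Complex.I))).im := by
  have h : W ν x * Complex.exp (-(ξ ν x * Complex.I)) = (amp ν x : ℂ) *
      (((-(x ^ 2 / (2 * (x ^ 2 - ν ^ 2)) * besselJnu ν x) - x * J1 ν x : ℝ) : ℂ) +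
        ((√(x ^ 2 - ν ^ 2) * besselJnu ν x : ℝ) : ℂ) * Complex.I) := by
    have h1 : Complex.exp (ξ ν x * Complex.I) * Complex.exp (-(ξ ν x * Complex.I)) = 1 := by
      rw [← Complex.exp_add]; simp
    unfold W
    linear_combination ((amp ν x : ℂ) *
      (((-(x ^ 2 / (2 * (x ^ 2 - ν ^ 2)) * besselJnu ν x) - x * J1 ν x : ℝ) : ℂ) +
        ((√(x ^ 2 - ν ^ 2) * besselJnu ν x : ℝ) : ℂ) * Complex.I)) * h1
  rw [h, Complex.im_ofReal_mul, Complex.add_im, Complex.im_ofReal_mul, Complex.ofReal_im,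
    Complex.I_im]
  linear_combination -(besselJnu ν x) * amp_sq hν hx

lemma norm_exp_neg (t : ℝ) : ‖Complex.exp (-(t * Complex.I))‖ = 1 := by
  have := Complex.norm_exp_ofReal_mul_I (-t)
  rwa [Complex.ofReal_neg, neg_mul] at this

lemma J_le {ν x : ℝ} (hν : 0 ≤ ν) (hx : ν < x) : |besselJnu ν x| ≤ amp ν x * ‖W ν x‖ := by
  rw [J_eq hν hx, abs_mul, abs_of_pos (amp_pos hν hx)]
  refine mul_le_mul_of_nonneg_left ?_ (amp_pos hν hx).le
  refine (Complex.abs_im_le_norm _).trans ?_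
  rw [norm_mul, norm_exp_neg, mul_one]

lemma Wstar_eq : ((2 / π : ℝ) : ℂ) * (Complex.I * (starRingEnd ℂ) G) =
    (√(2 / π) : ℝ) * (Complex.I * Complex.exp (((π / 4 : ℝ) : ℂ) * Complex.I)) := by
  have h : (2 / π) * √(π / 2) = √(2 / π) := by
    have e : π / 2 = (2 / π)⁻¹ := by rw [inv_div]
    have hp : 0 < 2 / π := by positivity
    rw [e, sqrt_inv]
    have h1 := mul_self_sqrt hp.le
    have h2 := sqrt_pos.2 hp
    rw [← div_eq_mul_inv, div_eq_iff h2.ne']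
    exact h1.symm
  rw [G_eq, map_mul, Complex.conj_ofReal, ← Complex.exp_conj, ← h]
  have e2 : (starRingEnd ℂ) (-((π : ℂ) / 4 * Complex.I)) = ((π / 4 : ℝ) : ℂ) * Complex.I := by
    have e3 : (π : ℂ) / 4 = ((π / 4 : ℝ) : ℂ) := by push_cast; rfl
    rw [e3, map_neg, map_mul, Complex.conj_ofReal, Complex.conj_I]
    ring
  rw [e2]
  push_cast
  ring

lemma Wstar_norm : ‖((2 / π : ℝ) : ℂ) * (Complex.I * (starRingEnd ℂ) G)‖ ≤ 1 := by
  rw [Wstar_eq, norm_mul, norm_mul, Complex.norm_exp_ofReal_mul_I, Complex.norm_I, mul_one, mul_one,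
    Complex.norm_real, Real.norm_eq_abs, abs_of_nonneg (sqrt_nonneg _), Real.sqrt_le_one,
    div_le_one pi_pos]
  linarith [pi_gt_three]

lemma target_eq (t : ℝ) : √(2 / π) * Real.cos (t - π / 4) =
    (((2 / π : ℝ) : ℂ) * (Complex.I * (starRingEnd ℂ) G) * Complex.exp (-(t * Complex.I))).im := by
  have e : ((2 / π : ℝ) : ℂ) * (Complex.I * (starRingEnd ℂ) G) * Complex.exp (-(t * Complex.I)) =
      (√(2 / π) : ℝ) * (Complex.I * Complex.exp (((π / 4 - t : ℝ) : ℂ) * Complex.I)) := by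
    rw [Wstar_eq, mul_assoc, mul_assoc, ← Complex.exp_add]
    congr 3
    push_cast; ring_nf
  rw [e, Complex.im_ofReal_mul, Complex.I_mul_im, Complex.exp_ofReal_mul_I_re,
    ← Real.cos_neg (t - π / 4), neg_sub]

lemma W_deriv_bound {ν y δ : ℝ} (hν : 0 ≤ ν) (hy : ν < y) (hδ : 0 < δ)
    (hPy : δ * y ^ 2 ≤ y ^ 2 - ν ^ 2) :
    ‖((amp ν y * (y * (y ^ 2 + 4 * ν ^ 2) / (4 * (y ^ 2 - ν ^ 2) ^ 2)) *
      besselJnu ν y : ℝ) : ℂ) * Complex.exp (ξ ν y * Complex.I)‖ ≤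
      (5 / (4 * δ ^ 2 * √δ)) / y ^ 2 * ‖W ν y‖ := by
  have hy0 : 0 < y := hν.trans_lt hy
  have hP := P_pos hν hy
  have ha := amp_pos hν hy
  have hJ := J_le hν hy
  have hsp := sqrt_pos.2 hP
  have hsd := sqrt_pos.2 hδ
  have haa := amp_sq hν hy
  rw [norm_mul, Complex.norm_exp_ofReal_mul_I, mul_one, Complex.norm_real, Real.norm_eq_abs, abs_mul,
    abs_of_nonneg (by positivity)]
  set ρ := y * (y ^ 2 + 4 * ν ^ 2) / (4 * (y ^ 2 - ν ^ 2) ^ 2) with hρ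
  have hρ0 : 0 ≤ ρ := by positivity
  have h1 : ρ ≤ 5 / (4 * δ ^ 2) / y := by
    have : ρ ≤ y * (5 * y ^ 2) / (4 * (δ * y ^ 2) ^ 2) := by
      rw [hρ]; gcongr; nlinarith
    refine this.trans (le_of_eq ?_)
    field_simp
  have h2 : amp ν y ^ 2 ≤ 1 / (√δ * y) := by
    have h3 : √δ * y ≤ √(y ^ 2 - ν ^ 2) := by
      rw [← sqrt_sq hy0.le, ← sqrt_mul hδ.le, sqrt_sq hy0.le]
      exact sqrt_le_sqrt hPy
    rw [le_div_iff₀ (by positivity), ← haa]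
    gcongr
  calc amp ν y * ρ * |besselJnu ν y| ≤ amp ν y * ρ * (amp ν y * ‖W ν y‖) := by gcongr
    _ = ρ * amp ν y ^ 2 * ‖W ν y‖ := by ring
    _ ≤ (5 / (4 * δ ^ 2) / y) * (1 / (√δ * y)) * ‖W ν y‖ := by gcongr
    _ = _ := by field_simp

end BJ

theorem besselJ_uniform_asymptotics (C : ℝ) (hC : 0 < C) :
    ∃ K : ℝ, 0 < K ∧ ∃ x₀ : ℝ, 0 < x₀ ∧ ∀ x : ℝ, x₀ ≤ x → ∀ ν : ℝ, 0 ≤ ν →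
      ν ≤ x / (1 + C) →
      |besselJnu ν x -
          (2 / π) ^ ((1:ℝ)/2) * (x ^ 2 - ν ^ 2) ^ (-(1:ℝ)/4) *
            Real.cos (π * x * gfun (ν / x) - π / 4)|
        ≤ K * (x ^ 2 - ν ^ 2) ^ (-(1:ℝ)/4) * x⁻¹ := by
  have hC1 : 0 < 1 + C := by linarith
  obtain ⟨δ, hδd⟩ : ∃ δ : ℝ, δ = 1 - (1 / (1 + C)) ^ 2 := ⟨_, rfl⟩
  have hq : 1 / (1 + C) < 1 := by rw [div_lt_one hC1]; linarith
  have hq0 : 0 < 1 / (1 + C) := by positivity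
  have hδ : 0 < δ := by rw [hδd]; nlinarith
  obtain ⟨c, hcd⟩ : ∃ c : ℝ, c = 5 / (4 * δ ^ 2 * √δ) := ⟨_, rfl⟩
  have hc : 0 < c := by rw [hcd]; have := Real.sqrt_pos.2 hδ; positivity
  refine ⟨c * Real.exp c, by positivity, 1, one_pos, fun x hx ν hν hνx => ?_⟩
  have hx0 : 0 < x := by linarith
  have hνx' : ν ≤ 1 / (1 + C) * x := by rw [one_div_mul_eq_div]; exact hνx
  have hlt : ∀ y, x ≤ y → ν < y := fun y hy => by nlinarith
  have hPy : ∀ y, x ≤ y → δ * y ^ 2 ≤ y ^ 2 - ν ^ 2 := fun y hy => by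
    have h1 : ν ≤ 1 / (1 + C) * y := hνx'.trans (by gcongr)
    have h2 : ν ^ 2 ≤ (1 / (1 + C) * y) ^ 2 := by gcongr
    rw [hδd]; nlinarith
  have key := BJ.wkb_abstract hx0 hc.le (fun y hy => BJ.W_deriv hν (hlt y hy))
    (fun y hy => by rw [hcd]; exact BJ.W_deriv_bound hν (hlt y hy) hδ (hPy y hy)) (BJ.W_tendsto hν)
  have hνx0 := hlt x le_rfl
  have ha := BJ.amp_pos hν hνx0
  have hxi : π * x * gfun (ν / x) = BJ.ξ ν x := by
    unfold gfun BJ.ξ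
    rw [BJ.sqrt_one_sub hx0]
    field_simp
  rw [hxi, ← Real.sqrt_eq_rpow]
  change |besselJnu ν x - √(2 / π) * BJ.amp ν x * _| ≤ _ * BJ.amp ν x * _
  have hdiff : besselJnu ν x - √(2 / π) * BJ.amp ν x * Real.cos (BJ.ξ ν x - π / 4) =
      BJ.amp ν x * ((BJ.W ν x - ((2 / π : ℝ) : ℂ) * (Complex.I * (starRingEnd ℂ) BJ.G)) *
        Complex.exp (-(BJ.ξ ν x * Complex.I))).im := by
    rw [sub_mul, Complex.sub_im, mul_sub, ← BJ.J_eq hν hνx0, ← BJ.target_eq]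
    ring
  rw [hdiff, abs_mul, abs_of_pos ha]
  have h1 := Complex.abs_im_le_norm ((BJ.W ν x - ((2 / π : ℝ) : ℂ) *
    (Complex.I * (starRingEnd ℂ) BJ.G)) * Complex.exp (-(BJ.ξ ν x * Complex.I)))
  rw [norm_mul, BJ.norm_exp_neg, mul_one] at h1
  have h2 : c * (Real.exp (c / x) * ‖((2 / π : ℝ) : ℂ) * (Complex.I * (starRingEnd ℂ) BJ.G)‖) / x ≤
      c * (Real.exp c * 1) / x := by
    have h3 := BJ.Wstar_norm
    have h4 : c / x ≤ c := div_le_self hc.le hx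
    gcongr
  calc _ ≤ BJ.amp ν x * (c * (Real.exp c * 1) / x) :=
        mul_le_mul_of_nonneg_left ((h1.trans key).trans h2) ha.le
    _ = _ := by rw [div_eq_mul_inv]; ring
end

section
/- Let C > 0. There exist K > 0 and x₀ > 0 such that for all x ≥ x₀ and all real ν with 0 ≤ ν ≤ x/(1+C): |J_ν′(x) + (2/π)^{1/2}·(x² − ν²)^{1/4}·x^{−1}·sin(πx·g(ν/x) − π/4)| ≤ K·(x² − ν²)^{1/4}·x^{−2}, where J_ν′(x) denotes the derivative of J_ν with respect to x. -/
open Real MeasureTheory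

open Filter Topology

lemma aux_tail (b : ℂ) (hb : 0 ≤ b.re) (hb1 : 1 ≤ ‖b‖) (R : ℝ) (hR : 0 < R) (T : ℝ) (hT : R ≤ T) :
    ‖∫ y in R..T, Complex.exp (-b * (y:ℂ)^2)‖ ≤ 2 / R := by
  have hb0 : b ≠ 0 := by
    intro h; rw [h] at hb1; simp at hb1; linarith
  have hcont : Continuous (fun y : ℝ => Complex.exp (-b * (y:ℂ)^2)) := by fun_prop
  have hnorm : ∀ y : ℝ, ‖Complex.exp (-b * (y:ℂ)^2)‖ ≤ 1 := by
    intro y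
    rw [Complex.norm_exp, Real.exp_le_one_iff]
    have : (-b * (y:ℂ)^2).re = - b.re * y^2 := by
      rw [← Complex.ofReal_pow, Complex.re_mul_ofReal]; simp
    rw [this]; nlinarith [sq_nonneg y]
  have hd : ∀ y : ℝ, y ≠ 0 → HasDerivAt (fun y : ℝ => Complex.exp (-b * (y:ℂ)^2) / (2 * b * y))
      (-Complex.exp (-b * (y:ℂ)^2) - Complex.exp (-b * (y:ℂ)^2) / (2 * b * y^2)) y := by
    intro y hy
    have hy' : (y:ℂ) ≠ 0 := by exact_mod_cast hy
    have h1 : HasDerivAt (fun z : ℂ => Complex.exp (-b * z^2) / (2 * b * z))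
      (-Complex.exp (-b * (y:ℂ)^2) - Complex.exp (-b * (y:ℂ)^2) / (2 * b * y^2)) (y:ℂ) := by
      have := ((((hasDerivAt_id (y:ℂ)).pow 2).const_mul (-b)).cexp).div
        ((hasDerivAt_id (y:ℂ)).const_mul (2*b)) (by simp [hb0, hy'])
      refine this.congr_deriv ?_
      simp only [id, Pi.pow_apply]; field_simp; ring
    exact h1.comp_ofReal
  have hi : ∀ y : ℝ, HasDerivAt (fun y : ℝ => ∫ s in R..y, Complex.exp (-b * (s:ℂ)^2))
      (Complex.exp (-b * (y:ℂ)^2)) y := fun y =>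
    intervalIntegral.integral_hasDerivAt_right (hcont.intervalIntegrable _ _)
      (hcont.stronglyMeasurableAtFilter _ _) hcont.continuousAt
  set f : ℝ → ℂ := fun y => (∫ s in R..y, Complex.exp (-b * (s:ℂ)^2)) +
    Complex.exp (-b * (y:ℂ)^2) / (2 * b * y) - Complex.exp (-b * (R:ℂ)^2) / (2 * b * R) with hf
  have hfd : ∀ y : ℝ, y ≠ 0 → HasDerivAt f (- (Complex.exp (-b * (y:ℂ)^2) / (2 * b * y^2))) y := by
    intro y hy
    have := ((hi y).add (hd y hy)).sub_const (Complex.exp (-b * (R:ℂ)^2) / (2 * b * R))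
    refine this.congr_deriv ?_
    ring
  have key : ‖f T‖ ≤ (1/R - 1/T) := by
    refine image_norm_le_of_norm_deriv_right_le_deriv_boundary' (f := f) (a := R) (b := T)
      (f' := fun y => - (Complex.exp (-b * (y:ℂ)^2) / (2 * b * y^2)))
      (B := fun y => 1/R - 1/y) (B' := fun y => 1/y^2) ?_ ?_ ?_ ?_ ?_ ?_ (Set.right_mem_Icc.2 hT)
    · intro y hy
      exact (hfd y (by linarith [hy.1])).continuousAt.continuousWithinAt
    · intro y hy
      exact (hfd y (by linarith [hy.1])).hasDerivWithinAt
    · simp [hf]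
    · intro y hy
      have : y ≠ 0 := by linarith [hy.1]
      apply ContinuousAt.continuousWithinAt
      fun_prop (disch := assumption)
    · intro y hy
      have : y ≠ 0 := by linarith [hy.1]
      have h := (hasDerivAt_inv this).const_sub (1/R)
      apply HasDerivAt.hasDerivWithinAt
      refine (h.congr_deriv (by simp)).congr_of_eventuallyEq (.of_forall fun z => by simp)
    · intro y hy
      have : 0 < y := by linarith [hy.1]
      rw [norm_neg, norm_div]
      have h2 : ‖2 * b * (y:ℂ)^2‖ = 2 * ‖b‖ * y^2 := by
        simp
      rw [h2]
      apply div_le_div₀ (by norm_num) (hnorm y) (by positivity)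
      nlinarith [sq_nonneg y]
  have hq : ∀ y : ℝ, 0 < y → ‖Complex.exp (-b * (y:ℂ)^2) / (2 * b * y)‖ ≤ 1 / (2*y) := by
    intro y hy
    rw [norm_div]
    have h2 : ‖2 * b * (y:ℂ)‖ = 2 * ‖b‖ * y := by
      simp [abs_of_pos hy]
    rw [h2]
    apply div_le_div₀ (by norm_num) (hnorm y) (by positivity)
    nlinarith
  have e : (∫ y in R..T, Complex.exp (-b * (y:ℂ)^2)) = f T -
    Complex.exp (-b * (T:ℂ)^2) / (2 * b * T) + Complex.exp (-b * (R:ℂ)^2) / (2 * b * R) := by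
    simp only [hf]; ring
  rw [e]
  have hT0 : 0 < T := by linarith
  calc _ ≤ ‖f T - Complex.exp (-b * (T:ℂ)^2) / (2 * b * T)‖ + _ := norm_add_le _ _
    _ ≤ ‖f T‖ + _ + _ := by gcongr; exact norm_sub_le _ _
    _ ≤ (1/R - 1/T) + 1/(2*T) + 1/(2*R) := by
      gcongr
      · exact hq T hT0
      · exact hq R hR
    _ ≤ 2 / R := by
      have : 1/(2*T) = 1/T/2 := by ring
      have h3 : 1/(2*R) = 1/R/2 := by ring
      have h4 : 2/R = 2*(1/R) := by ring
      have : 0 < 1/T := by positivity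
      have : 0 < 1/R := by positivity
      linarith

lemma aux_gauss (b : ℂ) (hb : 0 < b.re) (hb1 : 1 ≤ ‖b‖) (R : ℝ) (hR : 0 < R) :
    ‖(∫ y in (0:ℝ)..R, Complex.exp (-b * (y:ℂ)^2)) - (π / b) ^ (1 / 2 : ℂ) / 2‖ ≤ 2 / R := by
  have hcont : Continuous (fun y : ℝ => Complex.exp (-b * (y:ℂ)^2)) := by fun_prop
  have h1 := intervalIntegral_tendsto_integral_Ioi (0:ℝ)
    (integrable_cexp_neg_mul_sq hb).integrableOn (tendsto_id (α := ℝ) (x := atTop))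
  rw [integral_gaussian_complex_Ioi hb] at h1
  have h2 := (tendsto_const_nhds (x := ∫ y in (0:ℝ)..R, Complex.exp (-b * (y:ℂ)^2))).sub h1
  refine le_of_tendsto h2.norm ?_
  filter_upwards [eventually_ge_atTop R] with T hT
  have := aux_tail b hb.le hb1 R hR T hT
  rw [← intervalIntegral.integral_interval_sub_left (a := 0) (hcont.intervalIntegrable _ _)
    (hcont.intervalIntegrable _ _)] at this
  rw [norm_sub_rev]
  exact this

lemma aux_fresnel (R : ℝ) (hR : 0 < R) :
    ‖(∫ y in (0:ℝ)..R, Complex.exp (Complex.I * (y:ℂ)^2)) - (π * Complex.I) ^ (1 / 2 : ℂ) / 2‖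
      ≤ 2 / R := by
  have hc : Continuous (fun ε : ℝ => ∫ y in (0:ℝ)..R,
      Complex.exp (-((ε:ℂ) - Complex.I) * (y:ℂ)^2)) := by
    apply intervalIntegral.continuous_parametric_intervalIntegral_of_continuous'
    fun_prop
  have hp : ContinuousAt (fun ε : ℝ => ((π:ℂ) / ((ε:ℂ) - Complex.I)) ^ (1 / 2 : ℂ) / 2) 0 := by
    have h0 : ((0:ℝ):ℂ) - Complex.I ≠ 0 := by simp
    apply ContinuousAt.div_const
    apply ContinuousAt.cpow
    · fun_prop (disch := exact h0)
    · fun_prop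
    · right
      simp [Complex.div_im, Complex.normSq]
  have h := ((hc.continuousAt (x := 0)).sub hp).norm.tendsto.mono_left
    (nhdsWithin_le_nhds (s := Set.Ioi 0))
  have e1 : (π:ℂ) / (((0:ℝ):ℂ) - Complex.I) = π * Complex.I := by
    field_simp; simp
  simp only [Pi.sub_apply, e1] at h
  have e2 : ∀ y : ℝ, -(((0:ℝ):ℂ) - Complex.I) * (y:ℂ)^2 = Complex.I * (y:ℂ)^2 := by
    intro y; simp
  simp only [e2] at h
  refine le_of_tendsto h ?_
  filter_upwards [self_mem_nhdsWithin] with ε hε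
  apply aux_gauss _ _ _ R hR
  · simpa using hε
  · have := Complex.abs_im_le_norm ((ε:ℂ) - Complex.I)
    simpa using this

lemma aux_sqrt_pi_I : ((π:ℂ) * Complex.I) ^ (1 / 2 : ℂ) = (Real.sqrt π : ℂ) * Complex.exp (Complex.I * (π/4)) := by
  have h0 : (π:ℂ) * Complex.I ≠ 0 := by simp [Real.pi_ne_zero]
  rw [Complex.cpow_def_of_ne_zero h0]
  have : Complex.log ((π:ℂ) * Complex.I) = Real.log π + Complex.log Complex.I := by
    rw [Complex.log_ofReal_mul Real.pi_pos (by simp)]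
  rw [this, Complex.log_I, Real.sqrt_eq_rpow, Real.rpow_def_of_pos Real.pi_pos]
  push_cast
  rw [← Complex.exp_add]
  congr 1
  rw [Complex.ofReal_log Real.pi_pos.le]
  ring

lemma aux_fresnel_sym :
    Tendsto (fun R : ℝ => ∫ y in (-R)..R, Complex.exp (Complex.I * (y:ℂ)^2)) atTop
      (𝓝 ((Real.sqrt π : ℂ) * Complex.exp (Complex.I * (π/4)))) := by
  have hcont : Continuous (fun y : ℝ => Complex.exp (Complex.I * (y:ℂ)^2)) := by fun_prop
  have e : ∀ R : ℝ, (∫ y in (-R)..R, Complex.exp (Complex.I * (y:ℂ)^2)) =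
      2 * ∫ y in (0:ℝ)..R, Complex.exp (Complex.I * (y:ℂ)^2) := by
    intro R
    rw [← intervalIntegral.integral_add_adjacent_intervals (b := 0)
      (hcont.intervalIntegrable _ _) (hcont.intervalIntegrable _ _)]
    have := intervalIntegral.integral_comp_neg (a := 0) (b := R)
      (fun y : ℝ => Complex.exp (Complex.I * (y:ℂ)^2))
    simp only [Complex.ofReal_neg, neg_sq, neg_zero] at this
    rw [← this]; ring
  simp only [e]
  rw [← aux_sqrt_pi_I]
  have : Tendsto (fun R : ℝ => ∫ y in (0:ℝ)..R, Complex.exp (Complex.I * (y:ℂ)^2)) atTop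
      (𝓝 ((π * Complex.I) ^ (1 / 2 : ℂ) / 2)) := by
    rw [tendsto_iff_norm_sub_tendsto_zero]
    refine squeeze_zero' (.of_forall fun _ => norm_nonneg _) ?_
      (tendsto_const_nhds.div_atTop tendsto_id : Tendsto (fun R : ℝ => 2 / R) atTop (𝓝 0))
    filter_upwards [eventually_gt_atTop 0] with R hR using aux_fresnel R hR
  convert this.const_mul 2 using 2
  ring

lemma aux_osc0 (f : ℂ → ℂ) (hf : Differentiable ℂ f) (h0 : f 0 = 0) (c : ℂ) (hcre : c.re = 0)
    (hc1 : ‖c‖ = 1) :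
    ∃ K : ℝ, ∀ x : ℝ, 0 < x →
      ‖∫ u in (-(π/2))..(π/2), f (u:ℂ) * Complex.exp (c * x * Real.cos u)‖ ≤ K / x := by
  have hc0 : c ≠ 0 := by intro h; simp [h] at hc1
  set p : ℂ → ℂ := dslope f 0 with hp
  set q : ℂ → ℂ := dslope Complex.sin 0 with hq
  have hpd : Differentiable ℂ p := by
    rw [← differentiableOn_univ, hp, Complex.differentiableOn_dslope univ_mem]
    exact hf.differentiableOn
  have hqd : Differentiable ℂ q := by
    rw [← differentiableOn_univ, hq, Complex.differentiableOn_dslope univ_mem]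
    exact Complex.differentiable_sin.differentiableOn
  set U : Set ℂ := {z | q z ≠ 0} with hU
  have hUo : IsOpen U := isOpen_ne_fun hqd.continuous continuous_const
  set k : ℂ → ℂ := fun z => p z / q z with hk
  have hkd : DifferentiableOn ℂ k U := fun z hz =>
    ((hpd z).div (hqd z) hz).differentiableWithinAt
  have hkd' : ContinuousOn (deriv k) U := (hkd.deriv hUo).continuousOn
  have hmem : ∀ u : ℝ, u ∈ Set.uIcc (-(π/2)) (π/2) → (u:ℂ) ∈ U := by
    intro u hu
    rw [Set.uIcc_of_le (by linarith [Real.pi_pos])] at hu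
    simp only [hU, hq, Set.mem_ofPred_eq]
    by_cases h : u = 0
    · subst h
      simp [dslope_same]
    · rw [dslope_of_ne _ (by exact_mod_cast h), slope_def_field]
      simp only [Complex.sin_zero, sub_zero]
      apply div_ne_zero _ (by exact_mod_cast h)
      rw [← Complex.ofReal_sin]
      have := (Real.sin_eq_zero_iff_of_lt_of_lt (x := u) (by linarith [Real.pi_pos, hu.1]) (by linarith [Real.pi_pos, hu.2])).not.2 h
      exact_mod_cast this
  have hfk : ∀ u : ℝ, u ∈ Set.uIcc (-(π/2)) (π/2) → f u = k u * Real.sin u := by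
    intro u hu
    have hu := hmem u hu
    have h1 : (u:ℂ) * p u = f u := by
      have := sub_smul_dslope f 0 (u:ℂ)
      simpa [h0] using this
    have h2 : (u:ℂ) * q u = Complex.sin u := by
      have := sub_smul_dslope Complex.sin 0 (u:ℂ)
      simpa using this
    rw [← h1, Complex.ofReal_sin, ← h2]
    simp only [hk]
    have : q u ≠ 0 := hu
    field_simp
  have hkR : ∀ u ∈ Set.uIcc (-(π/2)) (π/2), HasDerivAt (fun u : ℝ => k u) (deriv k u) u := by
    intro u hu
    exact ((hkd.differentiableAt (hUo.mem_nhds (hmem u hu))).hasDerivAt).comp_ofReal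
  have hk'c : ContinuousOn (fun u : ℝ => deriv k (u:ℂ)) (Set.uIcc (-(π/2)) (π/2)) :=
    hkd'.comp Complex.continuous_ofReal.continuousOn (fun u hu => hmem u hu)
  refine ⟨‖k ((π/2 : ℝ):ℂ)‖ + ‖k ((-(π/2) : ℝ):ℂ)‖ + ∫ u in (-(π/2))..(π/2), ‖deriv k (u:ℂ)‖, ?_⟩
  intro x hx
  have hv : ∀ u ∈ Set.uIcc (-(π/2)) (π/2), HasDerivAt (fun u : ℝ => Complex.exp (c * x * Real.cos u))
      (Complex.exp (c * x * Real.cos u) * (c * x * ((-Real.sin u : ℝ):ℂ))) u := by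
    intro u _
    exact (((Real.hasDerivAt_cos u).ofReal_comp).const_mul (c*x)).cexp
  have hn : ∀ u : ℝ, ‖Complex.exp (c * x * Real.cos u)‖ = 1 := by
    intro u
    rw [Complex.norm_exp]
    have : (c * x * Real.cos u).re = 0 := by
      rw [Complex.re_mul_ofReal, Complex.re_mul_ofReal, hcre]; simp
    rw [this, Real.exp_zero]
  have ibp := intervalIntegral.integral_mul_deriv_eq_deriv_mul hkR hv hk'c.intervalIntegrable
    (Continuous.intervalIntegrable (by fun_prop) _ _)
  have hx0 : (x:ℂ) ≠ 0 := by exact_mod_cast hx.ne'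
  have e : (∫ u in (-(π/2))..(π/2), f (u:ℂ) * Complex.exp (c * x * Real.cos u)) =
      (-(1/(c*x))) * ∫ u in (-(π/2))..(π/2), k u *
        (Complex.exp (c * x * Real.cos u) * (c * x * ((-Real.sin u : ℝ):ℂ))) := by
    rw [← intervalIntegral.integral_const_mul]
    apply intervalIntegral.integral_congr
    intro u hu
    simp only
    rw [hfk u hu]
    push_cast
    field_simp
  rw [e, ibp, norm_mul]
  have h1 : ‖-(1/(c*x))‖ = 1 / x := by
    simp [hc1, abs_of_pos hx]
  rw [h1, div_mul_eq_mul_div, one_mul]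
  gcongr
  have hle : -(π/2) ≤ π/2 := by linarith [Real.pi_pos]
  calc _ ≤ _ + _ := norm_sub_le _ _
    _ ≤ (_ + _) + _ := by gcongr; exact norm_sub_le _ _
    _ ≤ _ := by
      rw [norm_mul, norm_mul, hn, hn, mul_one, mul_one]
      gcongr
      refine (intervalIntegral.norm_integral_le_integral_norm hle).trans (le_of_eq ?_)
      congr 1; ext u
      rw [norm_mul, hn, mul_one]

lemma aux_osc0_tendsto (f : ℂ → ℂ) (hf : Differentiable ℂ f) (h0 : f 0 = 0) (c : ℂ)
    (hcre : c.re = 0) (hc1 : ‖c‖ = 1) (w : ℝ → ℂ) (hw : ∀ x, ‖w x‖ = 1) :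
    Tendsto (fun x : ℝ => (Real.sqrt x : ℂ) * w x *
      ∫ u in (-(π/2))..(π/2), f (u:ℂ) * Complex.exp (c * x * Real.cos u)) atTop (𝓝 0) := by
  obtain ⟨K, hK⟩ := aux_osc0 f hf h0 c hcre hc1
  have ht : Tendsto (fun x : ℝ => K / Real.sqrt x) atTop (𝓝 0) :=
    tendsto_const_nhds.div_atTop Real.tendsto_sqrt_atTop
  refine squeeze_zero_norm' ?_ ht
  filter_upwards [eventually_gt_atTop 0] with x hx
  rw [norm_mul, norm_mul, hw, mul_one, Complex.norm_real, Real.norm_of_nonneg (Real.sqrt_nonneg x)]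
  have h1 := hK x hx
  calc _ ≤ √x * (K / x) := by gcongr
    _ = K / √x := by
      have := Real.mul_self_sqrt hx.le
      have h2 : √x ≠ 0 := (Real.sqrt_pos.2 hx).ne'
      field_simp
      rw [sq, this, mul_comm]

lemma aux_osc_main :
    Tendsto (fun x : ℝ => (Real.sqrt x : ℂ) * Complex.exp (Complex.I * x) *
      ∫ u in (-(π/2))..(π/2), Complex.cos ((u:ℂ)/2) * Complex.exp (-Complex.I * x * Real.cos u)) atTop
      (𝓝 (Real.sqrt (2 * π) * Complex.exp (Complex.I * (π/4)))) := by
  have h := (aux_fresnel_sym.comp Real.tendsto_sqrt_atTop).const_mul (Real.sqrt 2 : ℂ)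
  rw [Real.sqrt_mul (by norm_num), Complex.ofReal_mul, mul_assoc]
  refine h.congr' ?_
  filter_upwards [eventually_gt_atTop 0] with x hx
  simp only [Function.comp]
  have hsx : 0 < √x := Real.sqrt_pos.2 hx
  have hs2 : 0 < √2 := Real.sqrt_pos.2 (by norm_num)
  have hd : ∀ u : ℝ, HasDerivAt (fun u : ℝ => √2 * √x * Real.sin (u/2)) (√2 * √x * (Real.cos (u/2) * (1/2))) u :=
    fun u => (((hasDerivAt_id u).div_const 2).sin).const_mul (√2 * √x)
  have sub := intervalIntegral.integral_deriv_smul_comp (a := -(π/2)) (b := π/2)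
    (f := fun u : ℝ => √2 * √x * Real.sin (u/2)) (f' := fun u => √2 * √x * (Real.cos (u/2) * (1/2)))
    (g := fun y : ℝ => Complex.exp (Complex.I * (y:ℂ)^2)) (fun u _ => hd u)
    (Continuous.continuousOn (by fun_prop)) (by fun_prop)
  have e1 : √2 * √x * Real.sin (π/2/2) = √x := by
    rw [show π/2/2 = π/4 by ring, Real.sin_pi_div_four]
    have := Real.mul_self_sqrt (show (0:ℝ) ≤ 2 by norm_num)
    linear_combination (√x/2) * this
  have e2 : √2 * √x * Real.sin (-(π/2)/2) = -√x := by
    rw [show -(π/2)/2 = -(π/2/2) by ring, Real.sin_neg, mul_neg, e1]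
  rw [e1, e2] at sub
  rw [← sub, ← intervalIntegral.integral_const_mul, ← intervalIntegral.integral_const_mul]
  apply intervalIntegral.integral_congr
  intro u _
  simp only [Function.comp, Complex.real_smul]
  have hs : (√2:ℂ)^2 = 2 := by
    have := Real.sq_sqrt (show (0:ℝ) ≤ 2 by norm_num)
    exact_mod_cast this
  have hx2 : (√x:ℂ)^2 = x := by
    have := Real.sq_sqrt hx.le
    exact_mod_cast this
  have hexp : Complex.exp (Complex.I * ((√2 * √x * Real.sin (u/2) : ℝ):ℂ)^2) =
      Complex.exp (Complex.I * x) * Complex.exp (-Complex.I * x * Real.cos u) := by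
    rw [← Complex.exp_add]
    congr 1
    have h3 : Real.cos u = 1 - 2 * Real.sin (u/2)^2 := by
      have := Real.cos_two_mul (u/2)
      rw [show 2 * (u/2) = u by ring] at this
      rw [this, Real.cos_sq']; ring
    rw [h3]
    push_cast
    rw [mul_pow, mul_pow, hs, hx2]
    ring
  rw [hexp]
  push_cast
  linear_combination (1/2 : ℂ) * √x * Complex.cos (u/2) * (Complex.exp (Complex.I * x) * Complex.exp (-Complex.I * x * Complex.cos u)) * hs

lemma aux_osc (f : ℂ → ℂ) (hf : Differentiable ℂ f) :
    Tendsto (fun x : ℝ => (Real.sqrt x : ℂ) * Complex.exp (Complex.I * x) *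
      ∫ u in (-(π/2))..(π/2), f u * Complex.exp (-Complex.I * x * Real.cos u)) atTop
      (𝓝 (f 0 * (Real.sqrt (2 * π) * Complex.exp (Complex.I * (π/4))))) := by
  have h1 := aux_osc0_tendsto (fun z => f z - f 0 * Complex.cos (z/2))
    (hf.sub (by fun_prop)) (by simp) (-Complex.I) (by simp) (by simp)
    (fun x => Complex.exp (Complex.I * x)) (fun x => by rw [mul_comm]; exact Complex.norm_exp_ofReal_mul_I x)
  have h2 := (aux_osc_main.const_mul (f 0)).add h1
  rw [add_zero] at h2
  refine h2.congr fun x => ?_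
  have hfc := hf.continuous
  have : (∫ u in (-(π/2))..(π/2), f u * Complex.exp (-Complex.I * x * Real.cos u)) =
      f 0 * (∫ u in (-(π/2))..(π/2), Complex.cos ((u:ℂ)/2) * Complex.exp (-Complex.I * x * Real.cos u))
      + ∫ u in (-(π/2))..(π/2), (f u - f 0 * Complex.cos ((u:ℂ)/2)) * Complex.exp (-Complex.I * x * Real.cos u) := by
    rw [← intervalIntegral.integral_const_mul, ← intervalIntegral.integral_add
      (Continuous.intervalIntegrable (by fun_prop) _ _)
      (Continuous.intervalIntegrable (by fun_prop) _ _)]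
    congr 1; ext u; ring
  rw [this]; ring

noncomputable def auxS (ν : ℝ) (n : ℕ) (x : ℝ) : ℝ :=
  ∫ t in Set.Ioi (0:ℝ), Real.sinh t ^ n * Real.exp (-(x * Real.sinh t) - ν * t)

lemma aux_sinh_ge (t : ℝ) (ht : 0 ≤ t) : t ≤ Real.sinh t := Real.self_le_sinh_iff.2 ht

lemma aux_Sbound' (n : ℕ) (δ : ℝ) (hδ : 0 < δ) : ∀ x, δ ≤ x → ∀ ν : ℝ, 0 ≤ ν → ∀ t : ℝ, 0 < t →
    ‖Real.sinh t ^ n * Real.exp (-(x * Real.sinh t) - ν * t)‖ ≤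
      (n.factorial * (2/δ)^n) * Real.exp (-(δ/2) * t) := by
  intro x hx ν hν t ht
  have hs := aux_sinh_ge t ht.le
  have hs0 : 0 < Real.sinh t := by linarith
  rw [Real.norm_of_nonneg (by positivity)]
  have h1 := Real.pow_div_factorial_le_exp (δ/2 * Real.sinh t) (by positivity) n
  have h2 : Real.exp (-(x * Real.sinh t) - ν * t) ≤
      Real.exp (-(δ/2 * Real.sinh t)) * Real.exp (-(δ/2) * t) := by
    rw [← Real.exp_add, Real.exp_le_exp]
    nlinarith [mul_nonneg hν ht.le, mul_le_mul_of_nonneg_right hx hs0.le, mul_le_mul_of_nonneg_left hs hδ.le]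
  have h3 : Real.sinh t ^ n * Real.exp (-(δ/2 * Real.sinh t)) ≤ n.factorial * (2/δ)^n := by
    rw [Real.exp_neg, ← div_eq_mul_inv, div_le_iff₀ (Real.exp_pos _)]
    rw [div_le_iff₀ (by positivity), mul_pow] at h1
    have h4 : (2/δ)^n * (δ/2)^n = 1 := by
      rw [← mul_pow]; field_simp; simp
    calc Real.sinh t ^ n = (2/δ)^n * ((δ/2)^n * Real.sinh t ^ n) := by
          rw [← mul_assoc, h4, one_mul]
      _ ≤ (2/δ)^n * (Real.exp (δ/2 * Real.sinh t) * n.factorial) := by gcongr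
      _ = _ := by ring
  calc _ ≤ Real.sinh t ^ n * (Real.exp (-(δ/2 * Real.sinh t)) * Real.exp (-(δ/2) * t)) := by gcongr
    _ = (Real.sinh t ^ n * Real.exp (-(δ/2 * Real.sinh t))) * Real.exp (-(δ/2) * t) := by ring
    _ ≤ _ := by gcongr

lemma aux_Sbound (n : ℕ) (δ : ℝ) (hδ : 0 < δ) : ∃ K : ℝ, 0 ≤ K ∧ ∀ x, δ ≤ x → ∀ ν : ℝ, 0 ≤ ν → ∀ t : ℝ, 0 < t →
    ‖Real.sinh t ^ n * Real.exp (-(x * Real.sinh t) - ν * t)‖ ≤ K * Real.exp (-(δ/2) * t) := by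
  refine ⟨n.factorial * (2/δ)^n, by positivity, aux_Sbound' n δ hδ⟩

lemma aux_expint (δ : ℝ) (hδ : 0 < δ) (K : ℝ) :
    IntegrableOn (fun t : ℝ => K * Real.exp (-(δ/2) * t)) (Set.Ioi 0) :=
  (integrableOn_exp_mul_Ioi (by linarith) 0).const_mul K

lemma aux_Sint (ν : ℝ) (hν : 0 ≤ ν) (n : ℕ) (x : ℝ) (hx : 0 < x) :
    IntegrableOn (fun t : ℝ => Real.sinh t ^ n * Real.exp (-(x * Real.sinh t) - ν * t)) (Set.Ioi 0) := by
  obtain ⟨K, hK0, hK⟩ := aux_Sbound n x hx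
  refine Integrable.mono' (aux_expint x hx K) (Continuous.aestronglyMeasurable (by fun_prop)) ?_
  rw [ae_restrict_iff' measurableSet_Ioi]
  exact .of_forall fun t ht => hK x le_rfl ν hν t ht

lemma aux_Sderiv (ν : ℝ) (hν : 0 ≤ ν) (n : ℕ) (x : ℝ) (hx : 0 < x) :
    HasDerivAt (auxS ν n) (-auxS ν (n+1) x) x := by
  obtain ⟨K, hK0, hK⟩ := aux_Sbound (n+1) (x/2) (by linarith)
  have h := hasDerivAt_integral_of_dominated_loc_of_deriv_le (μ := volume.restrict (Set.Ioi (0:ℝ)))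
    (F := fun x t => Real.sinh t ^ n * Real.exp (-(x * Real.sinh t) - ν * t))
    (F' := fun x t => -(Real.sinh t ^ (n+1) * Real.exp (-(x * Real.sinh t) - ν * t)))
    (x₀ := x) (s := Set.Ioi (x/2)) (bound := fun t => K * Real.exp (-((x/2)/2) * t))
    (Ioi_mem_nhds (by linarith))
    (.of_forall fun y => Continuous.aestronglyMeasurable (by fun_prop))
    (aux_Sint ν hν n x hx) (Continuous.aestronglyMeasurable (by fun_prop))
    (by
      rw [ae_restrict_iff' measurableSet_Ioi]
      refine .of_forall fun t ht y hy => ?_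
      rw [norm_neg]
      exact hK y (le_of_lt hy) ν hν t ht)
    (aux_expint (x/2) (by linarith) K)
    (.of_forall fun t y _ => by
      have := ((((hasDerivAt_id y).mul_const (Real.sinh t)).neg.sub_const (ν*t)).exp).const_mul
        (Real.sinh t ^ n)
      refine this.congr_deriv ?_
      simp only [id, Pi.neg_apply]
      ring)
  refine h.2.congr_deriv ?_
  rw [integral_neg]; rfl

noncomputable def auxI (ν : ℝ) (x : ℝ) : ℝ := ∫ t in (0:ℝ)..π, Real.cos (x * Real.sin t - ν * t)
noncomputable def auxI1 (ν : ℝ) (x : ℝ) : ℝ := ∫ t in (0:ℝ)..π, -(Real.sin t * Real.sin (x * Real.sin t - ν * t))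
noncomputable def auxI2 (ν : ℝ) (x : ℝ) : ℝ := ∫ t in (0:ℝ)..π, -(Real.sin t ^ 2 * Real.cos (x * Real.sin t - ν * t))

lemma aux_Ideriv (ν x : ℝ) : HasDerivAt (auxI ν) (auxI1 ν x) x := by
  have h := intervalIntegral.hasDerivAt_integral_of_dominated_loc_of_deriv_le (μ := volume) (a := 0) (b := π)
    (F := fun x t => Real.cos (x * Real.sin t - ν * t))
    (F' := fun x t => -(Real.sin t * Real.sin (x * Real.sin t - ν * t)))
    (x₀ := x) (s := Set.univ) (bound := fun t => 1) univ_mem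
    (.of_forall fun y => Continuous.aestronglyMeasurable (by fun_prop))
    (Continuous.intervalIntegrable (by fun_prop) _ _) (Continuous.aestronglyMeasurable (by fun_prop))
    (.of_forall fun t _ y _ => by
      rw [norm_neg, norm_mul]
      exact mul_le_one₀ (Real.abs_sin_le_one _) (norm_nonneg _) (Real.abs_sin_le_one _))
    (Continuous.intervalIntegrable (by fun_prop) _ _)
    (.of_forall fun t _ y _ => by
      have := ((((hasDerivAt_id y).mul_const (Real.sin t)).sub_const (ν*t)).cos)
      refine this.congr_deriv ?_
      simp only [id]
      ring)
  exact h.2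

lemma aux_I1deriv (ν x : ℝ) : HasDerivAt (auxI1 ν) (auxI2 ν x) x := by
  have h := intervalIntegral.hasDerivAt_integral_of_dominated_loc_of_deriv_le (μ := volume) (a := 0) (b := π)
    (F := fun x t => -(Real.sin t * Real.sin (x * Real.sin t - ν * t)))
    (F' := fun x t => -(Real.sin t ^ 2 * Real.cos (x * Real.sin t - ν * t)))
    (x₀ := x) (s := Set.univ) (bound := fun t => 1) univ_mem
    (.of_forall fun y => Continuous.aestronglyMeasurable (by fun_prop))
    (Continuous.intervalIntegrable (by fun_prop) _ _) (Continuous.aestronglyMeasurable (by fun_prop))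
    (.of_forall fun t _ y _ => by
      rw [norm_neg, norm_mul, norm_pow]
      exact mul_le_one₀ (pow_le_one₀ (norm_nonneg _) (Real.abs_sin_le_one _)) (norm_nonneg _) (Real.abs_cos_le_one _))
    (Continuous.intervalIntegrable (by fun_prop) _ _)
    (.of_forall fun t _ y _ => by
      have := (((((hasDerivAt_id y).mul_const (Real.sin t)).sub_const (ν*t)).sin).const_mul (Real.sin t)).neg
      refine this.congr_deriv ?_
      simp only [id]
      ring)
  exact h.2

noncomputable def auxJ1 (ν x : ℝ) : ℝ := (1 / π) * auxI1 ν x + (Real.sin (ν * π) / π) * auxS ν 1 x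
noncomputable def auxJ2 (ν x : ℝ) : ℝ := (1 / π) * auxI2 ν x - (Real.sin (ν * π) / π) * auxS ν 2 x

lemma aux_besselJ_eq (ν : ℝ) : besselJnu ν = fun x => (1 / π) * auxI ν x - (Real.sin (ν * π) / π) * auxS ν 0 x := by
  ext x
  simp [besselJnu, auxI, auxS]

lemma aux_Jderiv (ν : ℝ) (hν : 0 ≤ ν) (x : ℝ) (hx : 0 < x) :
    HasDerivAt (besselJnu ν) (auxJ1 ν x) x := by
  rw [aux_besselJ_eq]
  refine (((aux_Ideriv ν x).const_mul _).sub ((aux_Sderiv ν hν 0 x hx).const_mul _)).congr_deriv ?_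
  simp only [auxJ1]; ring

lemma aux_J1deriv (ν : ℝ) (hν : 0 ≤ ν) (x : ℝ) (hx : 0 < x) :
    HasDerivAt (auxJ1 ν) (auxJ2 ν x) x := by
  refine (((aux_I1deriv ν x).const_mul _).add ((aux_Sderiv ν hν 1 x hx).const_mul _)).congr_deriv ?_
  simp only [auxJ2]; ring

lemma aux_I_ode (ν x : ℝ) : x^2 * auxI2 ν x + x * auxI1 ν x + (x^2 - ν^2) * auxI ν x =
    (x - ν) * Real.sin (ν * π) := by
  have hd : ∀ t ∈ Set.uIcc 0 π, HasDerivAt (fun t => (x * Real.cos t + ν) * Real.sin (x * Real.sin t - ν * t))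
      (x^2 * -(Real.sin t ^ 2 * Real.cos (x * Real.sin t - ν * t)) +
        x * -(Real.sin t * Real.sin (x * Real.sin t - ν * t)) +
        (x^2 - ν^2) * Real.cos (x * Real.sin t - ν * t)) t := by
    intro t _
    refine ((((Real.hasDerivAt_cos t).const_mul x).add_const ν).mul
      (((((Real.hasDerivAt_sin t).const_mul x).sub ((hasDerivAt_id t).const_mul ν))).sin)).congr_deriv ?_
    simp only [id, Pi.sub_apply]
    have := Real.sin_sq t
    rw [this]; ring
  have h := intervalIntegral.integral_eq_sub_of_hasDerivAt hd (Continuous.intervalIntegrable (by fun_prop) _ _)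
  rw [intervalIntegral.integral_add (Continuous.intervalIntegrable (by fun_prop) _ _)
    (Continuous.intervalIntegrable (by fun_prop) _ _),
    intervalIntegral.integral_add (Continuous.intervalIntegrable (by fun_prop) _ _)
    (Continuous.intervalIntegrable (by fun_prop) _ _), intervalIntegral.integral_const_mul,
    intervalIntegral.integral_const_mul, intervalIntegral.integral_const_mul] at h
  simp only [auxI, auxI1, auxI2]
  rw [h]
  simp
  ring

lemma aux_S_ode (ν : ℝ) (hν : 0 ≤ ν) (x : ℝ) (hx : 0 < x) :
    x^2 * auxS ν 2 x - x * auxS ν 1 x + (x^2 - ν^2) * auxS ν 0 x = x - ν := by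
  have hd : ∀ t ∈ Set.Ici (0:ℝ), HasDerivAt (fun t => -((x * Real.cosh t - ν) * Real.exp (-(x * Real.sinh t) - ν * t)))
      (x^2 * (Real.sinh t ^ 2 * Real.exp (-(x * Real.sinh t) - ν * t)) -
        x * (Real.sinh t ^ 1 * Real.exp (-(x * Real.sinh t) - ν * t)) +
        (x^2 - ν^2) * (Real.sinh t ^ 0 * Real.exp (-(x * Real.sinh t) - ν * t))) t := by
    intro t _
    refine ((((Real.hasDerivAt_cosh t).const_mul x).sub_const ν).mul
      ((((Real.hasDerivAt_sinh t).const_mul x).neg.sub ((hasDerivAt_id t).const_mul ν)).exp)).neg.congr_deriv ?_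
    simp only [id, Pi.sub_apply, Pi.neg_apply]
    have := Real.cosh_sq t
    linear_combination (x^2 * Real.exp (-(x * Real.sinh t) - ν * t)) * this
  have hi0 := (aux_Sint ν hν 0 x hx).const_mul (x^2-ν^2)
  have hi1 := (aux_Sint ν hν 1 x hx).const_mul x
  have hi2 := (aux_Sint ν hν 2 x hx).const_mul (x^2)
  have hlim : Tendsto (fun t => -((x * Real.cosh t - ν) * Real.exp (-(x * Real.sinh t) - ν * t))) atTop (𝓝 0) := by
    obtain ⟨K0, hK00, hK0⟩ := aux_Sbound 0 x hx
    obtain ⟨K1, hK10, hK1⟩ := aux_Sbound 1 x hx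
    have ht : Tendsto (fun t : ℝ => (x * K1 + (x + ν) * K0) * Real.exp (-(x/2) * t)) atTop (𝓝 0) := by
      have : Tendsto (fun t : ℝ => Real.exp (-(x/2) * t)) atTop (𝓝 0) :=
        Real.tendsto_exp_atBot.comp (tendsto_id.const_mul_atTop_of_neg (by linarith))
      simpa using this.const_mul (x * K1 + (x + ν) * K0)
    refine squeeze_zero_norm' ?_ ht
    filter_upwards [eventually_gt_atTop 0] with t ht
    have a0 := hK0 x le_rfl ν hν t ht
    have a1 := hK1 x le_rfl ν hν t ht
    have hs : 0 ≤ Real.sinh t := by linarith [aux_sinh_ge t ht.le]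
    rw [Real.norm_of_nonneg (by positivity)] at a0 a1
    rw [pow_zero, one_mul] at a0
    rw [pow_one] at a1
    have hc : Real.cosh t ≤ Real.sinh t + 1 := by
      have := Real.cosh_sq t
      nlinarith [Real.cosh_pos t]
    rw [norm_neg, norm_mul, Real.norm_of_nonneg (Real.exp_pos _).le]
    have hb : ‖x * Real.cosh t - ν‖ ≤ x * Real.sinh t + (x + ν) := by
      rw [Real.norm_eq_abs, abs_le]
      have := Real.cosh_pos t
      constructor <;> nlinarith
    calc _ ≤ (x * Real.sinh t + (x + ν)) * Real.exp (-(x * Real.sinh t) - ν * t) := by gcongr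
      _ = x * (Real.sinh t * Real.exp (-(x * Real.sinh t) - ν * t)) + (x+ν) * Real.exp (-(x * Real.sinh t) - ν * t) := by ring
      _ ≤ x * (K1 * Real.exp (-(x/2) * t)) + (x+ν) * (K0 * Real.exp (-(x/2) * t)) := by gcongr
      _ = _ := by ring
  have h := integral_Ioi_of_hasDerivAt_of_tendsto' hd ((hi2.sub hi1).add hi0) hlim
  have hA := integral_add (hi2.sub hi1) hi0
  have hB := integral_sub hi2 hi1
  simp only [Pi.sub_apply] at hA
  rw [hA, hB, integral_const_mul, integral_const_mul, integral_const_mul] at h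
  simp only [auxS]
  rw [h]
  simp

lemma aux_ode (ν : ℝ) (hν : 0 ≤ ν) (x : ℝ) (hx : 0 < x) :
    x^2 * auxJ2 ν x + x * auxJ1 ν x + (x^2 - ν^2) * besselJnu ν x = 0 := by
  rw [aux_besselJ_eq]
  simp only [auxJ1, auxJ2]
  linear_combination (1/π) * aux_I_ode ν x - (Real.sin (ν*π)/π) * aux_S_ode ν hν x hx

lemma aux_S_le (ν : ℝ) (hν : 0 ≤ ν) (n : ℕ) (x : ℝ) (hx : 0 < x) :
    |auxS ν n x| ≤ (n.factorial * (2/x)^n) * (2/x) := by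
  have h1 : ‖auxS ν n x‖ ≤ ∫ t in Set.Ioi (0:ℝ), (n.factorial * (2/x)^n) * Real.exp (-(x/2) * t) := by
    refine norm_integral_le_of_norm_le (aux_expint x hx _) ?_
    rw [ae_restrict_iff' measurableSet_Ioi]
    exact .of_forall fun t ht => aux_Sbound' n x hx x le_rfl ν hν t ht
  rw [integral_const_mul, integral_exp_mul_Ioi (by linarith)] at h1
  rw [Real.norm_eq_abs] at h1
  refine h1.trans (le_of_eq ?_)
  congr 1
  simp

lemma aux_S_lim (ν : ℝ) (hν : 0 ≤ ν) (n : ℕ) (w : ℝ → ℂ) (hw : ∀ x, ‖w x‖ = 1) :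
    Tendsto (fun x : ℝ => (Real.sqrt x : ℂ) * w x * (auxS ν n x : ℂ)) atTop (𝓝 0) := by
  have ht : Tendsto (fun x : ℝ => (n.factorial * 2^(n+1) : ℝ) / Real.sqrt x) atTop (𝓝 0) :=
    tendsto_const_nhds.div_atTop Real.tendsto_sqrt_atTop
  refine squeeze_zero_norm' ?_ ht
  filter_upwards [eventually_ge_atTop 1] with x hx
  have hx0 : 0 < x := by linarith
  rw [norm_mul, norm_mul, hw, mul_one, Complex.norm_real, Complex.norm_real,
    Real.norm_of_nonneg (Real.sqrt_nonneg x)]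
  have h1 := aux_S_le ν hν n x hx0
  rw [Real.norm_eq_abs]
  have h2 : (2/x)^n ≤ 2^n := by
    gcongr
    rw [div_le_iff₀ hx0]; linarith
  calc _ ≤ √x * ((n.factorial * 2^n) * (2/x)) := by gcongr; exact h1.trans (by gcongr)
    _ = _ := by
      have := Real.mul_self_sqrt hx0.le
      have h2 : √x ≠ 0 := (Real.sqrt_pos.2 hx0).ne'
      field_simp
      rw [sq, this]; ring

lemma aux_I_split (ν x : ℝ) : (auxI ν x : ℂ) + Complex.I * auxI1 ν x =
    (∫ u in (-(π/2))..(π/2), ((1 - Complex.cos u)/2 * Complex.exp (-Complex.I * ν * (u + π/2))) *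
      Complex.exp (Complex.I * x * Real.cos u)) +
    (∫ u in (-(π/2))..(π/2), ((1 + Complex.cos u)/2 * Complex.exp (Complex.I * ν * (u + π/2))) *
      Complex.exp (-Complex.I * x * Real.cos u)) := by
  have e1 : (auxI ν x : ℂ) + Complex.I * auxI1 ν x = ∫ t in (0:ℝ)..π,
      (((Real.cos (x * Real.sin t - ν * t) : ℝ) : ℂ) + Complex.I *
        ((-(Real.sin t * Real.sin (x * Real.sin t - ν * t)) : ℝ) : ℂ)) := by
    rw [intervalIntegral.integral_add (Continuous.intervalIntegrable (by fun_prop) _ _)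
      (Continuous.intervalIntegrable (by fun_prop) _ _), intervalIntegral.integral_const_mul,
      intervalIntegral.integral_ofReal, intervalIntegral.integral_ofReal]
    rfl
  have e2 := intervalIntegral.integral_comp_add_right (a := -(π/2)) (b := π/2) (fun t : ℝ =>
      (((Real.cos (x * Real.sin t - ν * t) : ℝ) : ℂ) + Complex.I *
        ((-(Real.sin t * Real.sin (x * Real.sin t - ν * t)) : ℝ) : ℂ))) (π/2)
  rw [show -(π/2) + π/2 = 0 by ring, show π/2 + π/2 = π by ring] at e2
  rw [e1, ← e2, ← intervalIntegral.integral_add (Continuous.intervalIntegrable (by fun_prop) _ _)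
      (Continuous.intervalIntegrable (by fun_prop) _ _)]
  congr 1
  ext u
  rw [Real.sin_add_pi_div_two]
  have h1 : Complex.exp (-Complex.I * ν * (u + π/2)) * Complex.exp (Complex.I * x * Real.cos u) =
      Complex.exp (((x * Real.cos u - ν * (u + π/2) : ℝ):ℂ) * Complex.I) := by
    rw [← Complex.exp_add]; congr 1; push_cast; ring
  have h2 : Complex.exp (Complex.I * ν * (u + π/2)) * Complex.exp (-Complex.I * x * Real.cos u) =
      Complex.exp (-((x * Real.cos u - ν * (u + π/2) : ℝ):ℂ) * Complex.I) := by
    rw [← Complex.exp_add]; congr 1; push_cast; ring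
  rw [mul_assoc ((1 - Complex.cos u)/2), mul_assoc ((1 + Complex.cos u)/2), h1, h2, Complex.exp_mul_I, Complex.exp_mul_I, Complex.cos_neg, Complex.sin_neg]
  push_cast
  ring

lemma aux_H_lim (ν : ℝ) (hν : 0 ≤ ν) :
    Tendsto (fun x : ℝ => (Real.sqrt x : ℂ) * Complex.exp (Complex.I * (x - ν * π / 2)) *
      (Complex.I * besselJnu ν x - auxJ1 ν x)) atTop
      (𝓝 (Complex.I * Real.sqrt (2/π) * Complex.exp (Complex.I * (π/4)))) := by
  have hn : ∀ x : ℝ, ‖Complex.exp (Complex.I * x)‖ = 1 := fun x => by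
    rw [mul_comm]; exact Complex.norm_exp_ofReal_mul_I x
  have h1 := aux_osc0_tendsto (fun z => (1 - Complex.cos z)/2 * Complex.exp (-Complex.I * ν * (z + π/2)))
    (by fun_prop) (by simp) Complex.I (by simp) (by simp) (fun x => Complex.exp (Complex.I * x)) hn
  have h2 := aux_osc (fun z => (1 + Complex.cos z)/2 * Complex.exp (Complex.I * ν * (z + π/2)))
    (by fun_prop)
  have h3 := aux_S_lim ν hν 0 (fun x => Complex.exp (Complex.I * x)) hn
  have h4 := aux_S_lim ν hν 1 (fun x => Complex.exp (Complex.I * x)) hn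
  have h := ((((h1.add h2).const_mul (1/π : ℂ)).sub
    ((h3.sub (h4.const_mul Complex.I)).const_mul (Real.sin (ν*π)/π : ℂ))).const_mul
      (Complex.I * Complex.exp (-(Complex.I * (ν * π / 2)))))
  have hpi : (π:ℂ) ≠ 0 := by exact_mod_cast Real.pi_ne_zero
  have key : Complex.I * Complex.exp (-(Complex.I * (ν * π / 2))) *
      (1/π * (0 + (1 + Complex.cos 0)/2 * Complex.exp (Complex.I * ν * (0 + π/2)) *
        (Real.sqrt (2 * π) * Complex.exp (Complex.I * (π/4)))) - Real.sin (ν*π)/π * (0 - Complex.I * 0)) =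
      (Complex.I * Real.sqrt (2/π) * Complex.exp (Complex.I * (π/4))) := by
    have e1 : Complex.exp (-(Complex.I * (ν * π / 2))) * Complex.exp (Complex.I * ν * (0 + π/2)) = 1 := by
      rw [← Complex.exp_add]
      rw [show -(Complex.I * (ν * π / 2)) + Complex.I * ν * (0 + π/2) = 0 by ring, Complex.exp_zero]
    have e2 : Real.sqrt (2 * π) = π * Real.sqrt (2/π) := by
      rw [show 2 * π = π^2 * (2/π) by field_simp [Real.pi_ne_zero], Real.sqrt_mul (by positivity),
        Real.sqrt_sq Real.pi_pos.le]
    rw [e2, Complex.cos_zero]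
    push_cast
    have e3 : (1/π * π : ℂ) = 1 := by field_simp
    linear_combination (Complex.I * Real.sqrt (2/π) * Complex.exp (Complex.I * (π/4))) * e1 * (1/π*π) +
      (Complex.I * Real.sqrt (2/π) * Complex.exp (Complex.I * (π/4))) * e3
  rw [key] at h
  refine h.congr fun x => ?_
  have hs := aux_I_split ν x
  have e4 : Complex.exp (Complex.I * (x - ν * π / 2)) = Complex.exp (-(Complex.I * (ν * π / 2))) * Complex.exp (Complex.I * x) := by
    rw [← Complex.exp_add]; congr 1; ring
  have e5 : Complex.I * besselJnu ν x - auxJ1 ν x = Complex.I * ((1/π : ℂ) * (auxI ν x + Complex.I * auxI1 ν x) -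
      (Real.sin (ν*π)/π : ℂ) * (auxS ν 0 x - Complex.I * auxS ν 1 x)) := by
    rw [aux_besselJ_eq]
    simp only [auxJ1]
    push_cast
    linear_combination (-(1/π : ℂ) * auxI1 ν x - (Complex.sin (ν*π)/π : ℂ) * auxS ν 1 x) * Complex.I_sq
  rw [e5, hs, e4]
  ring

lemma aux_growth (W W' : ℝ → ℂ) (w0 : ℂ) (L x : ℝ) (hL : 0 < L) (hx : L ≤ x)
    (hd : ∀ y, x ≤ y → HasDerivAt W (W' y) y)
    (hb : ∀ y, x ≤ y → ‖W' y‖ ≤ L / y^2 * ‖W y‖)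
    (hlim : Tendsto W atTop (𝓝 w0)) : ‖W x - w0‖ ≤ 3 * L * ‖w0‖ / x := by
  have hx0 : 0 < x := by linarith
  have hE : ∀ y, x ≤ y → HasDerivAt (fun y => Real.exp (-(2*L) * y⁻¹)) (Real.exp (-(2*L) * y⁻¹) * (2*L/y^2)) y := by
    intro y hy
    have hy0 : y ≠ 0 := by linarith
    refine (((hasDerivAt_inv hy0).const_mul (-(2*L))).exp).congr_deriv ?_
    ring
  have hN : ∀ y, x ≤ y → HasDerivAt (fun y => ‖W y‖^2 * Real.exp (-(2*L) * y⁻¹))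
      (2 * inner ℝ (W y) (W' y) * Real.exp (-(2*L) * y⁻¹) + ‖W y‖^2 * (Real.exp (-(2*L) * y⁻¹) * (2*L/y^2))) y :=
    fun y hy => ((hd y hy).norm_sq).mul (hE y hy)
  have hmono : MonotoneOn (fun y => ‖W y‖^2 * Real.exp (-(2*L) * y⁻¹)) (Set.Ici x) := by
    apply monotoneOn_of_deriv_nonneg (convex_Ici x)
    · exact fun y hy => (hN y hy).continuousAt.continuousWithinAt
    · intro y hy
      rw [interior_Ici] at hy
      exact (hN y (le_of_lt hy)).differentiableAt.differentiableWithinAt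
    · intro y hy
      rw [interior_Ici] at hy
      rw [(hN y (le_of_lt hy)).deriv]
      have h1 := abs_real_inner_le_norm (W y) (W' y)
      have h2 := hb y (le_of_lt hy)
      have h3 := (abs_le.1 h1).1
      have h4 : ‖W y‖ * ‖W' y‖ ≤ ‖W y‖^2 * (L / y^2) := by
        calc _ ≤ ‖W y‖ * (L / y^2 * ‖W y‖) := by gcongr
          _ = _ := by ring
      have h5 : 0 ≤ 2 * inner ℝ (W y) (W' y) + ‖W y‖^2 * (2*L/y^2) := by
        have : ‖W y‖^2 * (2*L/y^2) = 2 * (‖W y‖^2 * (L / y^2)) := by ring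
        linarith
      have := mul_nonneg h5 (Real.exp_pos (-(2*L) * y⁻¹)).le
      linarith
  have hlimN : Tendsto (fun y => ‖W y‖^2 * Real.exp (-(2*L) * y⁻¹)) atTop (𝓝 (‖w0‖^2)) := by
    have h1 : Tendsto (fun y : ℝ => Real.exp (-(2*L) * y⁻¹)) atTop (𝓝 1) := by
      have := (tendsto_inv_atTop_zero (𝕜 := ℝ)).const_mul (-(2*L))
      rw [mul_zero] at this
      have h := (Real.continuous_exp.tendsto 0).comp this
      rw [Real.exp_zero] at h
      exact h
    simpa using (hlim.norm.pow 2).mul h1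
  have hbd : ∀ y, x ≤ y → ‖W y‖ ≤ 3 * ‖w0‖ := by
    intro y hy
    have hy0 : 0 < y := by linarith
    have h1 : ‖W y‖^2 * Real.exp (-(2*L) * y⁻¹) ≤ ‖w0‖^2 := by
      refine ge_of_tendsto hlimN ?_
      filter_upwards [eventually_ge_atTop y] with z hz
      exact hmono hy (hy.trans hz) hz
    have h2 : Real.exp (-2) ≤ Real.exp (-(2*L) * y⁻¹) := by
      rw [Real.exp_le_exp]
      have : L * y⁻¹ ≤ 1 := by
        rw [← div_eq_mul_inv, div_le_one hy0]; linarith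
      linarith
    have h3 : ‖W y‖^2 ≤ ‖w0‖^2 * Real.exp 2 := by
      have : ‖W y‖^2 * Real.exp (-2) ≤ ‖w0‖^2 := le_trans (by gcongr) h1
      rw [Real.exp_neg, ← div_eq_mul_inv, div_le_iff₀ (Real.exp_pos _)] at this
      exact this
    have h4 : Real.exp 2 ≤ 9 := by
      have h5 : Real.exp 2 = Real.exp 1 ^ 2 := by rw [← Real.exp_nat_mul]; norm_num
      rw [h5]
      have := Real.exp_one_lt_three
      have := Real.exp_pos 1
      nlinarith
    apply le_of_sq_le_sq _ (by positivity)
    calc _ ≤ _ := h3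
      _ ≤ ‖w0‖^2 * 9 := by gcongr
      _ = _ := by ring
  have hz : ∀ z, x ≤ z → ‖W z - W x‖ ≤ 3 * L * ‖w0‖ / x - 3 * L * ‖w0‖ / z := by
    intro z hxz
    refine image_norm_le_of_norm_deriv_right_le_deriv_boundary' (f := fun y => W y - W x) (a := x) (b := z)
      (f' := W') (B := fun y => 3 * L * ‖w0‖ / x - 3 * L * ‖w0‖ / y)
      (B' := fun y => 3 * L * ‖w0‖ / y^2) ?_ ?_ ?_ ?_ ?_ ?_ (Set.right_mem_Icc.2 hxz)
    · intro y hy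
      exact ((hd y hy.1).sub_const _).continuousAt.continuousWithinAt
    · intro y hy
      exact ((hd y hy.1).sub_const _).hasDerivWithinAt
    · simp
    · intro y hy
      have : y ≠ 0 := by linarith [hy.1]
      apply ContinuousAt.continuousWithinAt
      fun_prop (disch := assumption)
    · intro y hy
      have : y ≠ 0 := by linarith [hy.1]
      have h := ((hasDerivAt_inv this).const_mul (3 * L * ‖w0‖)).const_sub (3 * L * ‖w0‖ / x)
      apply HasDerivAt.hasDerivWithinAt
      refine (h.congr_deriv (by ring)).congr_of_eventuallyEq (.of_forall fun z => by simp [div_eq_mul_inv])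
    · intro y hy
      have hy0 : 0 < y := by linarith [hy.1]
      calc _ ≤ L / y^2 * ‖W y‖ := hb y hy.1
        _ ≤ L / y^2 * (3 * ‖w0‖) := by gcongr; exact hbd y hy.1
        _ = _ := by ring
  rw [norm_sub_rev]
  refine le_of_tendsto (hlim.sub_const (W x)).norm ?_
  filter_upwards [eventually_ge_atTop x] with z hxz
  refine (hz z hxz).trans ?_
  have : 0 ≤ 3 * L * ‖w0‖ / z := by
    have : 0 < z := by linarith
    positivity
  linarith

noncomputable def auxs (ν y : ℝ) : ℝ := Real.sqrt (y^2 - ν^2)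
noncomputable def auxXi (ν y : ℝ) : ℝ := auxs ν y - ν * Real.arccos (ν / y)
noncomputable def auxA (ν y : ℝ) : ℂ := Complex.exp (Complex.I * auxXi ν y - (Real.log (auxs ν y) / 2 : ℝ))
noncomputable def auxB (ν y : ℝ) : ℂ := (Complex.I * auxs ν y - (y^2 / (2 * auxs ν y^2) : ℝ)) * auxA ν y
noncomputable def auxW (ν y : ℝ) : ℂ := besselJnu ν y * auxB ν y - y * auxJ1 ν y * auxA ν y

lemma auxs_pos {ν y : ℝ} (hν : 0 ≤ ν) (hy : ν < y) : 0 < auxs ν y := by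
  apply Real.sqrt_pos.2; nlinarith

lemma auxs_sq {ν y : ℝ} (hν : 0 ≤ ν) (hy : ν < y) : auxs ν y ^ 2 = y^2 - ν^2 := by
  apply Real.sq_sqrt; nlinarith

lemma auxs_deriv {ν y : ℝ} (hν : 0 ≤ ν) (hy : ν < y) : HasDerivAt (auxs ν) (y / auxs ν y) y := by
  have hp : y^2 - ν^2 ≠ 0 := by nlinarith
  have := (((hasDerivAt_id y).pow 2).sub_const (ν^2)).sqrt (by simpa using hp)
  refine this.congr_deriv ?_
  simp only [id, Pi.pow_apply, auxs]
  field_simp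
  norm_num

lemma auxXi_deriv {ν y : ℝ} (hν : 0 ≤ ν) (hy : ν < y) : HasDerivAt (auxXi ν) (auxs ν y / y) y := by
  have hy0 : 0 < y := by linarith
  have hs := auxs_pos hν hy
  have hs2 := auxs_sq hν hy
  have h1 : HasDerivAt (fun y : ℝ => ν / y) (-ν / y^2) y := by
    refine ((hasDerivAt_inv hy0.ne').const_mul ν).congr_deriv ?_
    ring
  have hr : ν / y < 1 := by rw [div_lt_one hy0]; exact hy
  have hr0 : 0 ≤ ν / y := by positivity
  have h2 := (Real.hasDerivAt_arccos (x := ν/y) (by linarith) (by linarith)).comp y h1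
  have hq : √(1 - (ν/y)^2) = auxs ν y / y := by
    rw [show 1 - (ν/y)^2 = (auxs ν y / y)^2 by rw [div_pow, div_pow, hs2]; field_simp]
    exact Real.sqrt_sq (by positivity)
  rw [hq] at h2
  refine ((auxs_deriv hν hy).sub (h2.const_mul ν)).congr_deriv ?_
  field_simp
  rw [hs2]

lemma auxA_deriv {ν y : ℝ} (hν : 0 ≤ ν) (hy : ν < y) : HasDerivAt (auxA ν)
    (auxA ν y * (Complex.I * auxs ν y - (y^2 / (2 * auxs ν y^2) : ℝ)) / y) y := by
  have hy0 : 0 < y := by linarith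
  have hs := auxs_pos hν hy
  have h1 := ((auxs_deriv hν hy).log hs.ne').div_const 2
  have h2 := (((auxXi_deriv hν hy).ofReal_comp.const_mul Complex.I).sub h1.ofReal_comp).cexp
  refine h2.congr_deriv ?_
  rw [mul_div_assoc]
  change auxA ν y * _ = _
  congr 1
  have : (y:ℂ) ≠ 0 := by exact_mod_cast hy0.ne'
  have : (auxs ν y:ℂ) ≠ 0 := by exact_mod_cast hs.ne'
  push_cast
  field_simp

lemma auxB_deriv {ν y : ℝ} (hν : 0 ≤ ν) (hy : ν < y) : HasDerivAt (auxB ν)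
    (auxA ν y / y * (- auxs ν y^2 + (5/4) * y^4/auxs ν y^4 - y^2/auxs ν y^2)) y := by
  have hy0 : 0 < y := by linarith
  have hs := auxs_pos hν hy
  have hyc : (y:ℂ) ≠ 0 := by exact_mod_cast hy0.ne'
  have hsc : (auxs ν y:ℂ) ≠ 0 := by exact_mod_cast hs.ne'
  have h1 : HasDerivAt (fun y => y^2 / (2 * auxs ν y^2)) (y / auxs ν y^2 - y^3/auxs ν y^4) y := by
    refine (((hasDerivAt_id y).pow 2).div (((auxs_deriv hν hy).pow 2).const_mul 2) (by simp [hs.ne'])).congr_deriv ?_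
    simp only [id, Pi.pow_apply]
    field_simp
    norm_num
    ring
  have h2 := (((auxs_deriv hν hy).ofReal_comp.const_mul Complex.I).sub h1.ofReal_comp).mul (auxA_deriv hν hy)
  refine h2.congr_deriv ?_
  simp only [Pi.sub_apply]
  push_cast
  field_simp
  ring_nf
  simp only [Complex.I_sq]
  ring

lemma auxW_deriv {ν y : ℝ} (hν : 0 ≤ ν) (hy : ν < y) : HasDerivAt (auxW ν)
    ((((5/4) * y^4/auxs ν y^4 - y^2/auxs ν y^2)/y : ℝ) * (besselJnu ν y * auxA ν y)) y := by
  have hy0 : 0 < y := by linarith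
  have hs := auxs_pos hν hy
  have hs2 := auxs_sq hν hy
  have hyc : (y:ℂ) ≠ 0 := by exact_mod_cast hy0.ne'
  have hsc : (auxs ν y:ℂ) ≠ 0 := by exact_mod_cast hs.ne'
  have hode := aux_ode ν hν y hy0
  rw [← hs2] at hode
  have hode' : (y:ℂ)^2 * auxJ2 ν y + y * auxJ1 ν y + auxs ν y^2 * besselJnu ν y = 0 := by exact_mod_cast hode
  have h := ((aux_Jderiv ν hν y hy0).ofReal_comp.mul (auxB_deriv hν hy)).sub
    (((hasDerivAt_id y).ofReal_comp.mul (aux_J1deriv ν hν y hy0).ofReal_comp).mul (auxA_deriv hν hy))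
  refine h.congr_deriv ?_
  simp only [id, auxB, Pi.mul_apply]
  push_cast
  have e : (y:ℂ) * auxJ2 ν y = -(auxJ1 ν y + auxs ν y^2 * besselJnu ν y / y) := by
    field_simp
    linear_combination hode'
  rw [e]
  field_simp
  ring

lemma auxA_norm (ν y : ℝ) : ‖auxA ν y‖ = Real.exp (-(Real.log (auxs ν y) / 2)) := by
  rw [auxA, Complex.norm_exp]
  congr 1
  simp

lemma auxA_norm_sq {ν y : ℝ} (hν : 0 ≤ ν) (hy : ν < y) : ‖auxA ν y‖ ^ 2 = 1 / auxs ν y := by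
  have hs := auxs_pos hν hy
  rw [auxA_norm, ← Real.exp_nat_mul]
  rw [show ((2:ℕ):ℝ) * -(Real.log (auxs ν y) / 2) = - Real.log (auxs ν y) by push_cast; ring]
  rw [Real.exp_neg, Real.exp_log hs, one_div]

lemma auxA_mul_conj {ν y : ℝ} (hν : 0 ≤ ν) (hy : ν < y) :
    auxA ν y * (starRingEnd ℂ) (auxA ν y) = ((1 / auxs ν y : ℝ) : ℂ) := by
  rw [Complex.mul_conj, Complex.normSq_eq_norm_sq, auxA_norm_sq hν hy]

lemma auxJ_im {ν y : ℝ} (hν : 0 ≤ ν) (hy : ν < y) :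
    (auxW ν y * (starRingEnd ℂ) (auxA ν y)).im = besselJnu ν y := by
  have hs := auxs_pos hν hy
  have : auxW ν y * (starRingEnd ℂ) (auxA ν y) =
    ((1 / auxs ν y : ℝ) : ℂ) * ((Complex.I * auxs ν y - (y^2 / (2 * auxs ν y^2) : ℝ)) * besselJnu ν y - y * auxJ1 ν y) := by
    rw [← auxA_mul_conj hν hy, auxW, auxB]; ring

  rw [this, Complex.im_ofReal_mul]
  simp only [Complex.sub_im, Complex.mul_im, Complex.mul_re, Complex.sub_re, Complex.I_re, Complex.I_im, Complex.ofReal_re, Complex.ofReal_im]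
  field_simp
  ring

lemma auxJ1_im {ν y : ℝ} (hν : 0 ≤ ν) (hy : ν < y) :
    (auxW ν y * (starRingEnd ℂ) (auxB ν y)).im = y * auxJ1 ν y := by
  have hs := auxs_pos hν hy
  have : auxW ν y * (starRingEnd ℂ) (auxB ν y) =
    ((1 / auxs ν y : ℝ) : ℂ) * (((Complex.I * auxs ν y - (y^2 / (2 * auxs ν y^2) : ℝ)) * besselJnu ν y - y * auxJ1 ν y)
      * (- Complex.I * auxs ν y - (y^2 / (2 * auxs ν y^2) : ℝ))) := by
    rw [← auxA_mul_conj hν hy, auxW, auxB]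
    simp only [map_mul, map_sub, Complex.conj_I, Complex.conj_ofReal]
    ring
  rw [this, Complex.im_ofReal_mul]
  simp only [Complex.sub_im, Complex.mul_im, Complex.mul_re, Complex.sub_re, Complex.I_re, Complex.I_im, Complex.ofReal_re, Complex.ofReal_im,
    Complex.neg_re, Complex.neg_im]
  field_simp
  ring

lemma auxW_bound {ν y m : ℝ} (hν : 0 ≤ ν) (hy : ν < y) (hm : 0 < m) (hms : m * y ≤ auxs ν y) :
    ‖((((5/4) * y^4/auxs ν y^4 - y^2/auxs ν y^2)/y : ℝ) : ℂ) * (besselJnu ν y * auxA ν y)‖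
      ≤ (((5/4)/m^4 + 1/m^2)/m) / y^2 * ‖auxW ν y‖ := by
  have hs := auxs_pos hν hy
  have hy0 : 0 < y := by linarith
  have hJ : |besselJnu ν y| ≤ ‖auxW ν y‖ * ‖auxA ν y‖ := by
    rw [← auxJ_im hν hy]
    refine (Complex.abs_im_le_norm _).trans ?_
    rw [norm_mul, Complex.norm_conj]
  have hr : y / auxs ν y ≤ 1 / m := by
    rw [div_le_div_iff₀ hs hm]; linarith
  have hr0 : 0 ≤ y / auxs ν y := by positivity
  have hq : |((5/4) * y^4/auxs ν y^4 - y^2/auxs ν y^2)| ≤ (5/4)/m^4 + 1/m^2 := by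
    have e1 : (5/4) * y^4/auxs ν y^4 = 5/4 * (y/auxs ν y)^4 := by rw [div_pow]; ring
    have e2 : y^2/auxs ν y^2 = (y/auxs ν y)^2 := by rw [div_pow]
    have e3 : (5/4)/m^4 + 1/m^2 = 5/4 * (1/m)^4 + (1/m)^2 := by rw [div_pow, div_pow]; ring
    rw [e1, e2, e3]
    have h4 : (y/auxs ν y)^4 ≤ (1/m)^4 := by gcongr
    have h2 : (y/auxs ν y)^2 ≤ (1/m)^2 := by gcongr
    have p4 : 0 ≤ (y/auxs ν y)^4 := by positivity
    have p2 : 0 ≤ (y/auxs ν y)^2 := by positivity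
    rw [abs_le]; constructor <;> linarith
  rw [norm_mul, norm_mul, Complex.norm_real, Complex.norm_real, Real.norm_eq_abs, Real.norm_eq_abs, abs_div, abs_of_pos hy0]
  have hs' : 1 / auxs ν y ≤ 1 / (m * y) := by
    apply one_div_le_one_div_of_le (by positivity) hms
  calc _ ≤ ((5/4)/m^4 + 1/m^2) / y * ((‖auxW ν y‖ * ‖auxA ν y‖) * ‖auxA ν y‖) := by gcongr
    _ = ((5/4)/m^4 + 1/m^2) / y * (‖auxW ν y‖ * ‖auxA ν y‖^2) := by ring
    _ ≤ ((5/4)/m^4 + 1/m^2) / y * (‖auxW ν y‖ * (1 / (m * y))) := by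
      rw [auxA_norm_sq hν hy]; gcongr
    _ = _ := by field_simp

lemma auxs_sub_lim (ν : ℝ) (hν : 0 ≤ ν) : Tendsto (fun y => auxs ν y - y) atTop (𝓝 0) := by
  have h1 : Tendsto (fun y : ℝ => -(ν^2 * y⁻¹)) atTop (𝓝 0) := by
    simpa using ((tendsto_inv_atTop_zero (𝕜 := ℝ)).const_mul (ν^2)).neg
  refine tendsto_of_tendsto_of_tendsto_of_le_of_le' h1 tendsto_const_nhds ?_ ?_
  · filter_upwards [eventually_gt_atTop ν] with y hy
    have hs := auxs_pos hν hy
    have hs2 := auxs_sq hν hy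
    have hy0 : 0 < y := by linarith
    rw [← div_eq_mul_inv, neg_le_sub_iff_le_add, ← sub_le_iff_le_add', le_div_iff₀ hy0]
    nlinarith
  · filter_upwards [eventually_gt_atTop ν] with y hy
    have hs := auxs_pos hν hy
    have hs2 := auxs_sq hν hy
    nlinarith

lemma auxs_div_lim (ν : ℝ) (hν : 0 ≤ ν) : Tendsto (fun y => auxs ν y / y) atTop (𝓝 1) := by
  have h := ((auxs_sub_lim ν hν).mul (tendsto_inv_atTop_zero (𝕜 := ℝ))).add_const 1
  simp only [mul_zero, zero_add] at h
  refine h.congr' ?_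
  filter_upwards [eventually_gt_atTop 0] with y hy
  field_simp
  ring

lemma auxc_lim (ν : ℝ) (hν : 0 ≤ ν) : Tendsto (fun y : ℝ => auxA ν y * (√y : ℂ) * Complex.exp (-(Complex.I * (y - ν * π / 2)))) atTop (𝓝 1) := by
  have h1 : Tendsto (fun y => auxXi ν y - y + ν * π / 2) atTop (𝓝 0) := by
    have ha : Tendsto (fun y : ℝ => Real.arccos (ν / y)) atTop (𝓝 (π / 2)) := by
      have := (tendsto_inv_atTop_zero (𝕜 := ℝ)).const_mul ν
      rw [mul_zero] at this
      have h := (Real.continuous_arccos.tendsto 0).comp this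
      rw [Real.arccos_zero] at h
      exact h
    have := ((auxs_sub_lim ν hν).sub (ha.const_mul ν)).add_const (ν * π / 2)
    rw [show 0 - ν * (π / 2) + ν * π / 2 = 0 by ring] at this
    refine this.congr fun y => ?_
    rw [auxXi]; ring
  have h2 : Tendsto (fun y => Real.log (auxs ν y / y) / 2) atTop (𝓝 0) := by
    have := ((auxs_div_lim ν hν).log one_ne_zero).div_const 2
    simpa using this
  have h3 : Tendsto (fun y : ℝ => Complex.exp (Complex.I * ((auxXi ν y - y + ν * π / 2 : ℝ) : ℂ) - ((Real.log (auxs ν y / y) / 2 : ℝ) : ℂ))) atTop (𝓝 1) := by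
    have a1 := ((Complex.continuous_ofReal.tendsto 0).comp h1).const_mul Complex.I
    have a2 := (Complex.continuous_ofReal.tendsto 0).comp h2
    have a3 := (Complex.continuous_exp.tendsto _).comp (a1.sub a2)
    rw [show Complex.I * ((0:ℝ):ℂ) - ((0:ℝ):ℂ) = 0 by simp, Complex.exp_zero] at a3
    exact a3
  refine h3.congr' ?_
  filter_upwards [eventually_gt_atTop ν, eventually_gt_atTop 0] with y hy hy0
  have hs := auxs_pos hν hy
  have e : (√y : ℂ) = Complex.exp ((Real.log y / 2 : ℝ) : ℂ) := by
    rw [← Complex.ofReal_exp, Real.exp_half, Real.exp_log hy0]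
  rw [e, auxA, ← Complex.exp_add, ← Complex.exp_add, Real.log_div hs.ne' hy0.ne']
  congr 1
  push_cast
  ring

lemma auxW_lim (ν : ℝ) (hν : 0 ≤ ν) : Tendsto (auxW ν) atTop (𝓝 (Complex.I * Real.sqrt (2/π) * Complex.exp (Complex.I*(π/4)))) := by
  have hH := aux_H_lim ν hν
  have hc := auxc_lim ν hν
  have hd : Tendsto (fun y : ℝ => ‖(Complex.I * ((auxs ν y - y : ℝ) : ℂ) - ((y^2 / (2 * auxs ν y^2) : ℝ) : ℂ)) * ((y⁻¹ : ℝ) : ℂ)‖) atTop (𝓝 0) := by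
    have a1 := ((Complex.continuous_ofReal.tendsto 0).comp (auxs_sub_lim ν hν)).const_mul Complex.I
    have b : Tendsto (fun y : ℝ => y^2 / (2 * auxs ν y^2)) atTop (𝓝 (1/2)) := by
      have := (((auxs_div_lim ν hν).inv₀ one_ne_zero).pow 2).div_const 2
      simp only [inv_one, one_pow] at this
      refine this.congr fun y => ?_
      rw [inv_div, div_pow, div_div, mul_comm]
    have a2 := (Complex.continuous_ofReal.tendsto _).comp b
    have a3 := (Complex.continuous_ofReal.tendsto _).comp (tendsto_inv_atTop_zero (𝕜 := ℝ))
    have := ((a1.sub a2).mul a3).norm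
    rw [show ‖(Complex.I * ((0:ℝ):ℂ) - ((1/2:ℝ):ℂ)) * ((0:ℝ):ℂ)‖ = 0 by simp] at this
    exact this
  have hG : Tendsto (fun y : ℝ => Complex.exp (Complex.I*(y - ν*π/2)) * (√y:ℂ) * besselJnu ν y *
      ((Complex.I * ((auxs ν y - y : ℝ) : ℂ) - ((y^2 / (2 * auxs ν y^2) : ℝ) : ℂ)) * ((y⁻¹ : ℝ) : ℂ))) atTop (𝓝 0) := by
    have := hH.norm.mul hd
    rw [mul_zero] at this
    refine squeeze_zero_norm (fun y => ?_) this
    rw [norm_mul _ (_ * ((y⁻¹ : ℝ) : ℂ))]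
    gcongr ?_ * _
    rw [mul_comm (Complex.exp _), norm_mul _ (besselJnu ν y : ℂ), norm_mul _ (_ - _)]
    gcongr
    rw [Complex.norm_real, Real.norm_eq_abs]
    have : besselJnu ν y = (Complex.I * besselJnu ν y - auxJ1 ν y).im := by simp
    conv_lhs => rw [this]
    exact Complex.abs_im_le_norm _
  have := hc.mul (hH.add hG)
  rw [add_zero, one_mul] at this
  refine this.congr' ?_
  filter_upwards [eventually_gt_atTop 0] with y hy0
  have hyc : (y:ℂ) ≠ 0 := by exact_mod_cast hy0.ne'
  have e1 : Complex.exp (-(Complex.I * (y - ν * π / 2))) * Complex.exp (Complex.I*(y - ν*π/2)) = 1 := by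
    rw [← Complex.exp_add]; simp
  have e2 : (√y:ℂ) * (√y:ℂ) = y := by
    rw [← Complex.ofReal_mul, Real.mul_self_sqrt hy0.le]
  have e3 : (y:ℂ) * ((y⁻¹ : ℝ) : ℂ) = 1 := by push_cast; field_simp
  rw [auxW, auxB]
  generalize Complex.exp (-(Complex.I * (y - ν * π / 2))) = E1 at *
  generalize Complex.exp (Complex.I*(y - ν*π/2)) = E2 at *
  generalize (√y : ℂ) = r at *
  generalize ((y⁻¹ : ℝ) : ℂ) = yi at *
  generalize auxA ν y = A at *
  rw [Complex.ofReal_sub]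
  generalize ((y^2 / (2 * auxs ν y^2) : ℝ) : ℂ) = a at *
  generalize (auxs ν y : ℂ) = s at *
  generalize (besselJnu ν y : ℂ) = J at *
  generalize (auxJ1 ν y : ℂ) = J1 at *
  linear_combination (A * r^2 * (Complex.I * J - J1) + A * r^2 * J * (Complex.I * (s - y) - a) * yi) * e1 +
    (A * (Complex.I * J - J1) + A * J * (Complex.I * (s - y) - a) * yi) * e2 + A * J * (Complex.I * (s - y) - a) * e3

lemma auxA_polar (ν y : ℝ) : auxA ν y = (‖auxA ν y‖ : ℂ) * Complex.exp (Complex.I * auxXi ν y) := by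
  rw [auxA_norm, auxA, sub_eq_add_neg, Complex.exp_add, Complex.ofReal_exp, mul_comm]
  push_cast
  rfl

lemma auxP_eq {ν y : ℝ} (hν : 0 ≤ ν) (hy : ν < y) :
    (y^2 - ν^2) ^ ((1:ℝ)/4) = auxs ν y * ‖auxA ν y‖ := by
  have hs := auxs_pos hν hy
  have hs2 := auxs_sq hν hy
  rw [auxA_norm, ← hs2, Real.rpow_def_of_pos (by positivity), Real.log_pow]
  nth_rewrite 2 [← Real.exp_log hs]
  rw [← Real.exp_add]
  congr 1
  push_cast
  ring

lemma auxXi_eq {ν y : ℝ} (hν : 0 ≤ ν) (hy : ν < y) : π * y * gfun (ν / y) = auxXi ν y := by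
  have hy0 : 0 < y := by linarith
  have hs := auxs_pos hν hy
  have hs2 := auxs_sq hν hy
  have hq : √(1 - (ν/y)^2) = auxs ν y / y := by
    rw [show 1 - (ν/y)^2 = (auxs ν y / y)^2 by rw [div_pow, div_pow, hs2]; field_simp]
    exact Real.sqrt_sq (by positivity)
  rw [gfun, hq, auxXi]
  have := Real.pi_pos
  field_simp

lemma aux_main_im (ν y : ℝ) :
    ((Complex.I * Real.sqrt (2/π) * Complex.exp (Complex.I*(π/4))) *
      (starRingEnd ℂ) (Complex.I * auxs ν y * auxA ν y)).im =
    - (Real.sqrt (2/π) * (auxs ν y * ‖auxA ν y‖) * Real.sin (auxXi ν y - π/4)) := by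
  have e : (Complex.I * Real.sqrt (2/π) * Complex.exp (Complex.I*(π/4))) *
      (starRingEnd ℂ) (Complex.I * auxs ν y * auxA ν y) =
      ((Real.sqrt (2/π) * (auxs ν y * ‖auxA ν y‖) : ℝ) : ℂ) * Complex.exp (((π/4 - auxXi ν y : ℝ) : ℂ) * Complex.I) := by
    conv_lhs => rw [auxA_polar]
    simp only [map_mul, Complex.conj_I, Complex.conj_ofReal, ← Complex.exp_conj]
    rw [show ((π/4 - auxXi ν y : ℝ) : ℂ) * Complex.I = Complex.I*(π/4) + -Complex.I * auxXi ν y by push_cast; ring, Complex.exp_add]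
    push_cast
    ring_nf
    simp only [Complex.I_sq]
    ring
  rw [e, Complex.im_ofReal_mul, Complex.exp_ofReal_mul_I_im, ← neg_sub, Real.sin_neg]
  ring

theorem besselJ_deriv_uniform_asymptotics (C : ℝ) (hC : 0 < C) :
    ∃ K : ℝ, 0 < K ∧ ∃ x₀ : ℝ, 0 < x₀ ∧ ∀ x : ℝ, x₀ ≤ x → ∀ ν : ℝ, 0 ≤ ν →
      ν ≤ x / (1 + C) →
      |deriv (fun y : ℝ => besselJnu ν y) x +
          (2 / π) ^ ((1:ℝ)/2) * (x ^ 2 - ν ^ 2) ^ ((1:ℝ)/4) * x⁻¹ *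
            Real.sin (π * x * gfun (ν / x) - π / 4)|
        ≤ K * (x ^ 2 - ν ^ 2) ^ ((1:ℝ)/4) * x ^ (-(2:ℝ)) := by
  have hpi := Real.pi_pos
  have hκ : 0 < 1 - (1/(1+C))^2 := by
    have h1 : 1/(1+C) < 1 := by rw [div_lt_one (by linarith)]; linarith
    have h0 : 0 < 1/(1+C) := by positivity
    nlinarith
  obtain ⟨m, hm, hm2⟩ : ∃ m : ℝ, 0 < m ∧ m^2 = 1 - (1/(1+C))^2 :=
    ⟨√(1 - (1/(1+C))^2), Real.sqrt_pos.2 hκ, Real.sq_sqrt hκ.le⟩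
  obtain ⟨L, hL⟩ : ∃ L : ℝ, L = ((5/4)/m^4 + 1/m^2)/m := ⟨_, rfl⟩
  have hL0 : 0 < L := by rw [hL]; positivity
  refine ⟨3 * L * (1 + 1/(2*m^3)) + 1/(2*m^3), by positivity, max L 1, by positivity, ?_⟩
  intro x hx ν hν hνx
  have hxL : L ≤ x := (le_max_left _ _).trans hx
  have hx1 : 1 ≤ x := (le_max_right _ _).trans hx
  have hx0 : 0 < x := by linarith
  have hlt : ν < x := by
    refine lt_of_le_of_lt hνx ?_
    rw [div_lt_iff₀ (by linarith)]; nlinarith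
  have hms : ∀ y, x ≤ y → m * y ≤ auxs ν y := by
    intro y hy
    apply Real.le_sqrt_of_sq_le
    have h1 : ν ≤ y * (1/(1+C)) := by
      refine hνx.trans ?_
      rw [div_eq_mul_one_div]; gcongr
    have h2 : ν^2 ≤ (y * (1/(1+C)))^2 := by gcongr
    rw [mul_pow, hm2]
    nlinarith
  have hW := aux_growth (auxW ν) _ _ L x hL0 hxL (fun y hy => auxW_deriv hν (by linarith))
    (fun y hy => by
      have := auxW_bound hν (by linarith) hm (hms y hy)
      rw [← hL] at this
      exact this) (auxW_lim ν hν)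
  have hJ1 := auxJ1_im hν hlt
  have hmain := aux_main_im ν x
  have hs := auxs_pos hν hlt
  have hmx := hms x le_rfl
  have hA0 : 0 ≤ ‖auxA ν x‖ := norm_nonneg _
  have hw0 : ‖Complex.I * (Real.sqrt (2/π) : ℂ) * Complex.exp (Complex.I*(π/4))‖ ≤ 1 := by
    rw [norm_mul, norm_mul, Complex.norm_I, Complex.norm_real, Complex.norm_exp]
    have : (Complex.I * ((π:ℂ)/4)).re = 0 := by
      rw [show (Complex.I * ((π:ℂ)/4)) = Complex.I * ((π/4 : ℝ) : ℂ) by push_cast; ring]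
      simp
    rw [this, Real.exp_zero, one_mul, mul_one, Real.norm_eq_abs, abs_of_nonneg (Real.sqrt_nonneg _)]
    rw [Real.sqrt_le_one]
    rw [div_le_one hpi]
    linarith [Real.pi_gt_three]
  rw [(aux_Jderiv ν hν x hx0).deriv, auxP_eq hν hlt, auxXi_eq hν hlt, ← Real.sqrt_eq_rpow]
  rw [Real.rpow_neg hx0.le, Real.rpow_two]
  generalize Complex.I * (Real.sqrt (2/π) : ℂ) * Complex.exp (Complex.I*(π/4)) = w0 at *
  obtain ⟨a, ha⟩ : ∃ a : ℝ, a = x^2 / (2 * auxs ν x^2) := ⟨_, rfl⟩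
  have ha0 : 0 ≤ a := by rw [ha]; positivity
  have ham : a ≤ 1/(2*m^2) := by
    rw [ha, div_le_div_iff₀ (by positivity) (by positivity)]
    have : (m*x)^2 ≤ auxs ν x^2 := by gcongr
    nlinarith
  have hB : auxB ν x = Complex.I * auxs ν x * auxA ν x - (a:ℂ) * auxA ν x := by
    rw [auxB, ← ha]; ring
  have hdiff : x * auxJ1 ν x + √(2/π) * (auxs ν x * ‖auxA ν x‖) * Real.sin (auxXi ν x - π/4) =
      ((auxW ν x - w0) * (starRingEnd ℂ) (auxB ν x) - w0 * (starRingEnd ℂ) ((a:ℂ) * auxA ν x)).im := by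
    have : (auxW ν x - w0) * (starRingEnd ℂ) (auxB ν x) - w0 * (starRingEnd ℂ) ((a:ℂ) * auxA ν x) =
      auxW ν x * (starRingEnd ℂ) (auxB ν x) - w0 * (starRingEnd ℂ) (Complex.I * auxs ν x * auxA ν x) := by
      rw [hB, map_sub]; ring
    rw [this, Complex.sub_im, hJ1, hmain]; ring
  have hBn : ‖auxB ν x‖ ≤ auxs ν x * ‖auxA ν x‖ + a * ‖auxA ν x‖ := by
    rw [hB]
    refine (norm_sub_le _ _).trans (le_of_eq ?_)
    simp only [norm_mul, Complex.norm_I, Complex.norm_real, Real.norm_eq_abs, abs_of_pos hs, abs_of_nonneg ha0, one_mul]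
  have haA : a * ‖auxA ν x‖ ≤ 1/(2*m^3) * (auxs ν x * ‖auxA ν x‖) / x := by
    calc a * ‖auxA ν x‖ ≤ 1/(2*m^2) * ‖auxA ν x‖ := by gcongr
      _ = 1/(2*m^3) * ((m * x) * ‖auxA ν x‖) / x := by field_simp
      _ ≤ _ := by gcongr
  have haA' : a * ‖auxA ν x‖ ≤ 1/(2*m^3) * (auxs ν x * ‖auxA ν x‖) :=
    haA.trans (div_le_self (by positivity) hx1)
  have hWn : ‖auxW ν x - w0‖ ≤ 3 * L / x := by
    refine hW.trans ?_
    have h3 : 3 * L * ‖w0‖ ≤ 3 * L := mul_le_of_le_one_right (by positivity) hw0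
    exact div_le_div_of_nonneg_right h3 hx0.le
  have hfin : |x * auxJ1 ν x + √(2/π) * (auxs ν x * ‖auxA ν x‖) * Real.sin (auxXi ν x - π/4)| ≤
      (3 * L * (1 + 1/(2*m^3)) + 1/(2*m^3)) * (auxs ν x * ‖auxA ν x‖) / x := by
    rw [hdiff]
    calc _ ≤ _ := Complex.abs_im_le_norm _
      _ ≤ _ := norm_sub_le _ _
      _ = ‖auxW ν x - w0‖ * ‖auxB ν x‖ + ‖w0‖ * (a * ‖auxA ν x‖) := by
        rw [norm_mul, norm_mul, Complex.norm_conj, Complex.norm_conj, norm_mul, Complex.norm_real, Real.norm_eq_abs, abs_of_nonneg ha0]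
      _ ≤ (3 * L / x) * (auxs ν x * ‖auxA ν x‖ + 1/(2*m^3) * (auxs ν x * ‖auxA ν x‖)) + 1 * (1/(2*m^3) * (auxs ν x * ‖auxA ν x‖) / x) := by
        gcongr
        exact hBn.trans (by linarith)
      _ = _ := by ring
  have e : auxJ1 ν x + √(2/π) * (auxs ν x * ‖auxA ν x‖) * x⁻¹ * Real.sin (auxXi ν x - π/4) =
      (x * auxJ1 ν x + √(2/π) * (auxs ν x * ‖auxA ν x‖) * Real.sin (auxXi ν x - π/4)) / x := by
    field_simp
  rw [e, abs_div, abs_of_pos hx0, div_le_iff₀ hx0]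
  refine hfin.trans (le_of_eq ?_)
  field_simp
end
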